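/- Let k ≥ 1. If d = 2^k + 1, then 𝔪_ℝ(d) = 2d − 1; that is, there exists a tuple of 2d − 1 real symmetric d×d matrices with the phase retrieval property on ℝ^d, and any tuple of real symmetric d×d matrices with the phase retrieval property on ℝ^d has at least 2d − 1 members. If d = 2^k + 2, then 𝔪_ℝ(d) = 2d − 2: there exists a phase retrievable tuple of 2d − 2 real symmetric d×d matrices, and any phase retrievable tuple has at least 2d − 2 members. -/

import Mathlib

open Matrix

/-- A tuple of real symmetric `d×d` matrices has the phase retrieval property on `ℝ^d`
if equality of all quadratic measurements implies equality up to sign. -/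
def PhaseRetrievableR {d N : ℕ} (A : Fin N → Matrix (Fin d) (Fin d) ℝ) : Prop :=
  ∀ x y : Fin d → ℝ,
    (∀ j, x ⬝ᵥ (A j) *ᵥ x = y ⬝ᵥ (A j) *ᵥ y) → x = y ∨ x = -y

namespace CubicalFan

/-! ### Cubical cochains

A cell of the cubical subdivision of `ℝ^d` is encoded by a list of integers, an odd entry `c`
standing for the open interval `(c - 1, c + 1)` and an even entry for a vertex. -/

section Coboundary

variable {R : Type*} [CommRing R]

/-- The sign `-1` of an interval, `1` of a vertex. -/
def par (R : Type*) [CommRing R] (c : ℤ) : R := if Odd c then -1 else 1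

/-- The sign `(-1) ^ dim u`. -/
def sg (R : Type*) [CommRing R] : List ℤ → R
  | [] => 1
  | c :: u => par R c * sg R u

/-- The cubical coboundary of a cochain. -/
def cobd : (List ℤ → R) → List ℤ → R
  | _, [] => 0
  | f, c :: u => (if Odd c then f ((c + 1) :: u) - f ((c - 1) :: u) else 0)
      + par R c * cobd (fun w => f (c :: w)) u

/-- The indicator cochain of the vertices. -/
def vert (R : Type*) [CommRing R] : List ℤ → R
  | [] => 1
  | c :: u => (if Odd c then 0 else 1) * vert R u

/-- The antipode of a cell. -/
def ng (u : List ℤ) : List ℤ := u.map Neg.neg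

/-- `Face y u` says that the cell `y` is a face of `u`. -/
def Face (y u : List ℤ) : Prop :=
  List.Forall₂ (fun a b => a = b ∨ (Odd b ∧ (a = b + 1 ∨ a = b - 1))) y u

@[simp] lemma cobd_nil (f : List ℤ → R) : cobd f [] = 0 := rfl

lemma cobd_cons (f : List ℤ → R) (c : ℤ) (u : List ℤ) :
    cobd f (c :: u) = (if Odd c then f ((c + 1) :: u) - f ((c - 1) :: u) else 0)
      + par R c * cobd (fun w => f (c :: w)) u := rfl

lemma par_of_odd {c : ℤ} (h : Odd c) : par R c = -1 := if_pos h

lemma par_of_not_odd {c : ℤ} (h : ¬ Odd c) : par R c = 1 := if_neg h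

lemma not_odd_add_one {c : ℤ} (h : Odd c) : ¬ Odd (c + 1) := by
  rw [Int.not_odd_iff_even]; exact h.add_one

lemma not_odd_sub_one {c : ℤ} (h : Odd c) : ¬ Odd (c - 1) := by
  rw [Int.not_odd_iff_even]; exact h.sub_odd odd_one

lemma cobd_of_odd (f : List ℤ → R) {c : ℤ} (h : Odd c) (u : List ℤ) :
    cobd f (c :: u) = f ((c + 1) :: u) - f ((c - 1) :: u) - cobd (fun w => f (c :: w)) u := by
  rw [cobd_cons, if_pos h, par_of_odd h]; ring

lemma cobd_of_not_odd (f : List ℤ → R) {c : ℤ} (h : ¬ Odd c) (u : List ℤ) :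
    cobd f (c :: u) = cobd (fun w => f (c :: w)) u := by
  rw [cobd_cons, if_neg h, par_of_not_odd h]; ring

lemma cobd_add (f g : List ℤ → R) (u : List ℤ) :
    cobd (fun w => f w + g w) u = cobd f u + cobd g u := by
  induction u generalizing f g with
  | nil => simp
  | cons c u ih => simp only [cobd_cons, ih]; split_ifs <;> ring

lemma cobd_mul_left (r : R) (f : List ℤ → R) (u : List ℤ) :
    cobd (fun w => r * f w) u = r * cobd f u := by
  induction u generalizing f with
  | nil => simp
  | cons c u ih => simp only [cobd_cons, ih]; split_ifs <;> ring

lemma cobd_zero (u : List ℤ) : cobd (fun _ => (0 : R)) u = 0 := by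
  simpa using cobd_mul_left (0 : R) (fun _ => 0) u

lemma cobd_neg (f : List ℤ → R) (u : List ℤ) : cobd (fun w => -f w) u = -cobd f u := by
  simpa using cobd_mul_left (-1 : R) f u

lemma cobd_sub (f g : List ℤ → R) (u : List ℤ) :
    cobd (fun w => f w - g w) u = cobd f u - cobd g u := by
  simp only [sub_eq_add_neg, cobd_add, cobd_neg]

lemma cobd_linearMap {β : Type*} (Φ : (β → R) →ₗ[R] R) (f : List ℤ → β → R) (u : List ℤ) :
    cobd (fun w => Φ (f w)) u = Φ (fun v => cobd (fun w => f w v) u) := by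
  induction u generalizing f with
  | nil => exact (map_zero Φ).symm
  | cons c u ih =>
    by_cases h : Odd c
    · simp only [cobd_of_odd _ h, ih]
      rw [← map_sub, ← map_sub]; rfl
    · simp only [cobd_of_not_odd _ h, ih]

/-- Evaluation of the coboundary on a cell, as a linear functional. -/
def cobdAt (u : List ℤ) : (List ℤ → R) →ₗ[R] R where
  toFun f := cobd f u
  map_add' f g := cobd_add f g u
  map_smul' r f := cobd_mul_left r f u

lemma cobd_comm (f : List ℤ → List ℤ → R) (u v : List ℤ) :
    cobd (fun w => cobd (f w) v) u = cobd (fun x => cobd (fun w => f w x) u) v :=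
  cobd_linearMap (cobdAt v) f u

lemma cobd_ringHom {S : Type*} [CommRing S] (φ : R →+* S) (f : List ℤ → R) (u : List ℤ) :
    cobd (fun w => φ (f w)) u = φ (cobd f u) := by
  induction u generalizing f with
  | nil => simp
  | cons c u ih =>
    simp only [cobd_cons, ih, par]; split_ifs <;> simp

lemma cobd_cobd (f : List ℤ → R) (u : List ℤ) : cobd (cobd f) u = 0 := by
  induction u generalizing f with
  | nil => simp
  | cons c u ih =>
    by_cases h : Odd c
    · rw [cobd_of_odd _ h, cobd_of_not_odd _ (not_odd_add_one h),
        cobd_of_not_odd _ (not_odd_sub_one h)]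
      simp only [cobd_of_odd _ h, cobd_sub]
      rw [ih]
      ring
    · rw [cobd_of_not_odd _ h]
      simp only [cobd_of_not_odd _ h]
      exact ih _

lemma cobd_vert (u : List ℤ) : cobd (vert R) u = 0 := by
  induction u with
  | nil => simp
  | cons c u ih =>
    by_cases h : Odd c
    · rw [cobd_of_odd _ h]
      simp [vert, h, not_odd_add_one h, not_odd_sub_one h, cobd_zero]
    · rw [cobd_of_not_odd _ h]
      simpa [vert, h] using ih

lemma odd_neg' {c : ℤ} : Odd (-c) ↔ Odd c := _root_.odd_neg

lemma cobd_ng (f : List ℤ → R) (u : List ℤ) :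
    cobd (fun w => f (ng w)) u = -cobd f (ng u) := by
  induction u generalizing f with
  | nil => simp [ng]
  | cons c u ih =>
    have e : ∀ a (w : List ℤ), ng (a :: w) = -a :: ng w := fun a w => rfl
    by_cases h : Odd c
    · have h' : Odd (-c) := odd_neg'.2 h
      simp only [cobd_of_odd _ h, e, cobd_of_odd _ h']
      rw [ih (fun w => f (-c :: w)), show -(c + 1) = -c - 1 by ring, show -(c - 1) = -c + 1 by ring]
      ring
    · have h' : ¬ Odd (-c) := fun H => h (odd_neg'.1 H)
      simp only [cobd_of_not_odd _ h, e, cobd_of_not_odd _ h']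
      exact ih (fun w => f (-c :: w))

lemma par_mul_self (c : ℤ) : par R c * par R c = 1 := by
  by_cases h : Odd c <;> simp [par, h]

lemma sg_mul_self (u : List ℤ) : sg R u * sg R u = 1 := by
  induction u with
  | nil => simp [sg]
  | cons c u ih =>
    calc _ = (par R c * par R c) * (sg R u * sg R u) := by simp only [sg]; ring
      _ = 1 := by rw [par_mul_self, ih, one_mul]

@[simp] lemma sg_ng (u : List ℤ) : sg R (ng u) = sg R u := by
  induction u with
  | nil => rfl
  | cons c u ih =>
    change par R (-c) * sg R (ng u) = par R c * sg R u
    rw [ih, par, par, if_congr odd_neg' rfl rfl]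

@[simp] lemma vert_ng (u : List ℤ) : vert R (ng u) = vert R u := by
  induction u with
  | nil => rfl
  | cons c u ih =>
    change (if Odd (-c) then 0 else 1) * vert R (ng u) = (if Odd c then 0 else 1) * vert R u
    rw [ih, if_congr odd_neg' rfl rfl]

lemma sg_mul_vert (u : List ℤ) : sg R u * vert R u = vert R u := by
  induction u with
  | nil => simp [sg]
  | cons c u ih =>
    by_cases h : Odd c <;> simp [sg, vert, par, h, ih]

lemma cobd_sg_mul (g : List ℤ → R) (u : List ℤ) :
    cobd (fun w => sg R w * g w) u = -(sg R u * cobd g u) := by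
  induction u generalizing g with
  | nil => simp
  | cons c u ih =>
    by_cases h : Odd c
    · simp only [cobd_of_odd _ h, sg, par_of_not_odd (not_odd_add_one h),
        par_of_not_odd (not_odd_sub_one h), mul_assoc, par_of_odd h, cobd_mul_left, ih]
      ring
    · simp only [cobd_of_not_odd _ h, sg, par_of_not_odd h, ih, one_mul]

lemma Face.refl (u : List ℤ) : Face u u := by
  induction u with
  | nil => exact .nil
  | cons c u ih => exact .cons (.inl rfl) ih

lemma Face.trans {x y z : List ℤ} (h : Face x y) (h' : Face y z) : Face x z := by
  induction h generalizing z with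
  | nil => exact h'
  | cons hab _ ih =>
    cases h' with
    | cons hbc h' =>
      refine .cons ?_ (ih h')
      rcases hab with rfl | ⟨ho, hab⟩
      · exact hbc
      · rcases hbc with rfl | ⟨hc, rfl | rfl⟩
        · exact .inr ⟨ho, hab⟩
        · exact absurd ho (not_odd_add_one hc)
        · exact absurd ho (not_odd_sub_one hc)

lemma cobd_congr {f g : List ℤ → R} {u : List ℤ} (h : ∀ y, Face y u → f y = g y) :
    cobd f u = cobd g u := by
  induction u generalizing f g with
  | nil => rfl
  | cons c u ih =>
    have h1 : cobd (fun w => f (c :: w)) u = cobd (fun w => g (c :: w)) u :=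
      ih fun y hy => h _ (.cons (.inl rfl) hy)
    by_cases ho : Odd c
    · rw [cobd_of_odd _ ho, cobd_of_odd _ ho, h1,
        h _ (.cons (.inr ⟨ho, .inl rfl⟩) (Face.refl u)),
        h _ (.cons (.inr ⟨ho, .inr rfl⟩) (Face.refl u))]
    · rw [cobd_of_not_odd _ ho, cobd_of_not_odd _ ho, h1]

end Coboundary

section Total

variable {R : Type*} [CommRing R]

/-- The coboundary of a cochain on the product of two cubical complexes. -/
def tcobd (f : List ℤ → List ℤ → R) (u v : List ℤ) : R :=
  cobd (fun w => f w v) u + sg R u * cobd (f u) v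

lemma tcobd_congr {f g : List ℤ → List ℤ → R} {u v : List ℤ}
    (h : ∀ y z, Face y u → Face z v → f y z = g y z) : tcobd f u v = tcobd g u v := by
  rw [tcobd, tcobd, cobd_congr fun y hy => h y v hy (.refl v),
    cobd_congr fun z hz => h u z (.refl u) hz]

lemma tcobd_add (f g : List ℤ → List ℤ → R) (u v : List ℤ) :
    tcobd (fun a b => f a b + g a b) u v = tcobd f u v + tcobd g u v := by
  simp only [tcobd, cobd_add]; ring

lemma tcobd_mul_left (r : R) (f : List ℤ → List ℤ → R) (u v : List ℤ) :
    tcobd (fun a b => r * f a b) u v = r * tcobd f u v := by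
  simp only [tcobd, cobd_mul_left]; ring

lemma tcobd_sub (f g : List ℤ → List ℤ → R) (u v : List ℤ) :
    tcobd (fun a b => f a b - g a b) u v = tcobd f u v - tcobd g u v := by
  simp only [tcobd, cobd_sub]; ring

lemma tcobd_zero (u v : List ℤ) : tcobd (fun _ _ => (0 : R)) u v = 0 := by
  simp [tcobd, cobd_zero]

lemma tcobd_tcobd (f : List ℤ → List ℤ → R) (u v : List ℤ) : tcobd (tcobd f) u v = 0 := by
  have h1 : cobd (fun w => tcobd f w v) u = -(sg R u * cobd (fun w => cobd (f w) v) u) := by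
    simp only [tcobd, cobd_add, cobd_sg_mul]
    rw [cobd_cobd, zero_add]
  have h2 : cobd (tcobd f u) v = cobd (fun x => cobd (fun w => f w x) u) v := by
    change cobd (fun x => cobd (fun w => f w x) u + sg R u * cobd (f u) x) v = _
    rw [cobd_add, cobd_mul_left, cobd_cobd,
      mul_zero, add_zero]
  rw [tcobd, h1, h2, cobd_comm]; ring

lemma tcobd_vert (u v : List ℤ) : tcobd (fun a b => vert R a * vert R b) u v = 0 := by
  simp only [tcobd, cobd_mul_left]
  rw [show (fun w => vert R w * vert R v) = fun w => vert R v * vert R w by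
    funext w; ring, cobd_mul_left]
  rw [cobd_vert, cobd_vert]; ring

lemma tcobd_ringHom {S : Type*} [CommRing S] (φ : R →+* S) (f : List ℤ → List ℤ → R)
    (u v : List ℤ) (hs : φ (sg R u) = sg S u) :
    tcobd (fun a b => φ (f a b)) u v = φ (tcobd f u v) := by
  simp only [tcobd, map_add, map_mul, ← cobd_ringHom, hs]

lemma sg_ringHom {S : Type*} [CommRing S] (φ : R →+* S) (u : List ℤ) :
    φ (sg R u) = sg S u := by
  induction u with
  | nil => simp [sg]
  | cons c u ih => simp [sg, ih, par, apply_ite φ]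

end Total
/-! ### Cochains attached to a labelling -/

/-- Signed labels with `m` colours. -/
abbrev Lab (m : ℕ) := Fin m × Bool

/-- The opposite label. -/
def lneg {m : ℕ} (l : Lab m) : Lab m := (l.1, !l.2)

/-- Negation of all the labels of a list. -/
def lng {m : ℕ} (L : List (Lab m)) : List (Lab m) := L.map lneg

@[simp] lemma lneg_lneg {m : ℕ} (l : Lab m) : lneg (lneg l) = l := by simp [lneg]

@[simp] lemma lng_lng {m : ℕ} (L : List (Lab m)) : lng (lng L) = L := by
  simp [lng, Function.comp_def]

@[simp] lemma lng_cons {m : ℕ} (l : Lab m) (L : List (Lab m)) :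
    lng (l :: L) = lneg l :: lng L := rfl

@[simp] lemma lng_nil {m : ℕ} : lng ([] : List (Lab m)) = [] := rfl

section Chains

variable {R : Type*} [CommRing R] {m : ℕ}

/-- The coboundary on cochains of lists of labels. -/
def ldiff {Λ : Type*} : (List Λ → R) → List Λ → R
  | _, [] => 0
  | φ, a :: L => φ L - ldiff (fun K => φ (a :: K)) L

lemma ldiff_add {Λ : Type*} (φ ψ : List Λ → R) (L : List Λ) :
    ldiff (fun K => φ K + ψ K) L = ldiff φ L + ldiff ψ L := by
  induction L generalizing φ ψ with
  | nil => simp [ldiff]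
  | cons a L ih => simp only [ldiff, ih]; ring

lemma ldiff_mul_left {Λ : Type*} (r : R) (φ : List Λ → R) (L : List Λ) :
    ldiff (fun K => r * φ K) L = r * ldiff φ L := by
  induction L generalizing φ with
  | nil => simp [ldiff]
  | cons a L ih => simp only [ldiff, ih]; ring

/-- Evaluation of `ldiff` on a list, as a linear functional. -/
def ldiffAt {Λ : Type*} (L : List Λ) : (List Λ → R) →ₗ[R] R where
  toFun φ := ldiff φ L
  map_add' φ ψ := ldiff_add φ ψ L
  map_smul' r φ := ldiff_mul_left r φ L

lemma tcobd_ldiff {Λ : Type*} (F : List ℤ → List ℤ → List Λ → R) (L : List Λ) (u v : List ℤ) :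
    tcobd (fun a b => ldiff (F a b) L) u v = ldiff (fun K => tcobd (fun a b => F a b K) u v) L := by
  have h1 := cobd_linearMap (ldiffAt (R := R) L) (fun w => F w v) u
  have h2 := cobd_linearMap (ldiffAt (R := R) L) (F u) v
  simp only [ldiffAt, LinearMap.coe_mk, AddHom.coe_mk] at h1 h2
  simp only [tcobd, ldiff_add, ldiff_mul_left, h1, h2]

/-- The iterated pull-back of a cochain `φ` on lists of labels along the labelling `lab`. -/
def chn (lab : List ℤ → List ℤ → Lab m) (φ : List (Lab m) → R) :
    ℕ → List ℤ → List ℤ → List (Lab m) → R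
  | 0, u, v, L => vert R u * vert R v * φ (lab u v :: L)
  | p + 1, u, v, L => tcobd (fun a b => chn lab φ p a b (lab u v :: L)) u v

/-- The boundary term in `chn_ldiff`. -/
def bchn (lab : List ℤ → List ℤ → Lab m) (φ : List (Lab m) → R) :
    ℕ → List ℤ → List ℤ → List (Lab m) → R
  | 0, u, v, L => vert R u * vert R v * φ L
  | p + 1, u, v, L => tcobd (fun a b => chn lab φ p a b L) u v

variable (lab : List ℤ → List ℤ → Lab m)

lemma chn_succ (φ : List (Lab m) → R) (p : ℕ) (u v : List ℤ) (L : List (Lab m)) :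
    chn lab φ (p + 1) u v L = tcobd (fun a b => chn lab φ p a b (lab u v :: L)) u v := rfl

lemma tcobd_bchn (φ : List (Lab m) → R) (p : ℕ) (u v : List ℤ) (L : List (Lab m)) :
    tcobd (fun a b => bchn lab φ p a b L) u v = 0 := by
  cases p with
  | zero =>
    simp only [bchn]
    rw [show (fun a b => vert R a * vert R b * φ L) = fun a b => φ L * (vert R a * vert R b) by
      funext a b; ring, tcobd_mul_left, tcobd_vert, mul_zero]
  | succ p => exact tcobd_tcobd _ u v

lemma chn_ldiff (φ : List (Lab m) → R) (p : ℕ) (u v : List ℤ) (L : List (Lab m)) :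
    chn lab (ldiff φ) p u v L =
      (-1) ^ p * (bchn lab φ p u v L - ldiff (chn lab φ p u v) L) := by
  induction p generalizing u v L with
  | zero =>
    have : ldiff (chn lab φ 0 u v) L
        = vert R u * vert R v * ldiff (fun K => φ (lab u v :: K)) L := by
      rw [← ldiff_mul_left]; rfl
    rw [this]
    simp only [chn, bchn, ldiff]; ring
  | succ p ih =>
    have h3 : ldiff (chn lab φ (p + 1) u v) L
        = tcobd (fun a b => ldiff (fun K => chn lab φ p a b (lab u v :: K)) L) u v := by
      rw [tcobd_ldiff]; rfl
    simp only [chn_succ, ih, tcobd_mul_left, tcobd_sub, tcobd_bchn]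
    simp only [ldiff, tcobd_sub]
    rw [h3, bchn]; ring

lemma chn_congr {φ ψ : List (Lab m) → R} (P : Lab m → Prop) (p : ℕ) (u v : List ℤ)
    (L : List (Lab m)) (hP : ∀ a b, Face a u → Face b v → P (lab a b)) (hL : ∀ l ∈ L, P l)
    (h : ∀ K : List (Lab m), K.length = p + 1 + L.length → (∀ l ∈ K, P l) → φ K = ψ K) :
    chn lab φ p u v L = chn lab ψ p u v L := by
  induction p generalizing u v L with
  | zero =>
    simp only [chn]
    rw [h _ (by simp; omega) fun l hl => (List.mem_cons.1 hl).elim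
      (fun e => e ▸ hP u v (.refl u) (.refl v)) (hL l)]
  | succ p ih =>
    simp only [chn_succ]
    refine tcobd_congr fun y z hy hz => ih y z _
      (fun a b ha hb => hP a b (ha.trans hy) (hb.trans hz)) ?_ ?_
    · intro l hl
      rcases List.mem_cons.1 hl with rfl | hl
      · exact hP u v (.refl u) (.refl v)
      · exact hL l hl
    · intro K hK
      exact h K (by rw [hK]; simp; omega)

lemma chn_add (φ ψ : List (Lab m) → R) (p : ℕ) (u v : List ℤ) (L : List (Lab m)) :
    chn lab (fun K => φ K + ψ K) p u v L = chn lab φ p u v L + chn lab ψ p u v L := by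
  induction p generalizing u v L with
  | zero => simp only [chn]; ring
  | succ p ih => simp only [chn_succ, ih, tcobd_add]

lemma chn_zero (p : ℕ) (u v : List ℤ) (L : List (Lab m)) :
    chn lab (fun _ => (0 : R)) p u v L = 0 := by
  induction p generalizing u v L with
  | zero => simp [chn]
  | succ p ih => simp only [chn_succ, ih, tcobd_zero]

lemma vert_ringHom {S : Type*} [CommRing S] (g : R →+* S) (u : List ℤ) :
    g (vert R u) = vert S u := by
  induction u with
  | nil => simp [vert]
  | cons c u ih => simp [vert, ih, apply_ite g]

lemma chn_ringHom {S : Type*} [CommRing S] (g : R →+* S) (φ : List (Lab m) → R) (p : ℕ)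
    (u v : List ℤ) (L : List (Lab m)) :
    chn lab (fun K => g (φ K)) p u v L = g (chn lab φ p u v L) := by
  induction p generalizing u v L with
  | zero => simp [chn, vert_ringHom]
  | succ p ih => simp only [chn_succ, ih, tcobd_ringHom g _ _ _ (sg_ringHom g u)]

variable {lab}

lemma chn_ng_left {u v : List ℤ}
    (h : ∀ a b, Face a u → Face b v → lab (ng a) b = lneg (lab a b))
    (φ : List (Lab m) → R) (p : ℕ) (L : List (Lab m)) :
    chn lab φ p (ng u) v L = sg R u * chn lab (fun K => φ (lng K)) p u v (lng L) := by
  induction p generalizing u v L with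
  | zero =>
    rw [chn, chn, vert_ng, h u v (.refl u) (.refl v), lng_cons, lng_lng, ← mul_assoc,
      ← mul_assoc, sg_mul_vert]
  | succ p ih =>
    have hL : lng (lab (ng u) v :: L) = lab u v :: lng L := by
      rw [h u v (.refl u) (.refl v), lng_cons, lneg_lneg]
    rw [chn_succ, chn_succ, tcobd, tcobd, ← neg_neg (cobd _ (ng u)), ← cobd_ng, sg_ng,
      cobd_congr fun y hy => ih (fun a b ha hb => h a b (ha.trans hy) hb) _, cobd_sg_mul,
      cobd_congr fun y hy => ih (fun a b ha hb => h a b ha (hb.trans hy)) _, cobd_mul_left, hL]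
    ring

lemma chn_ng_right {u v : List ℤ}
    (h : ∀ a b, Face a u → Face b v → lab a (ng b) = lneg (lab a b))
    (φ : List (Lab m) → R) (p : ℕ) (L : List (Lab m)) :
    chn lab φ p u (ng v) L = sg R v * chn lab (fun K => φ (lng K)) p u v (lng L) := by
  induction p generalizing u v L with
  | zero =>
    rw [chn, chn, vert_ng, h u v (.refl u) (.refl v), lng_cons, lng_lng]
    linear_combination -(vert R u * φ (lneg (lab u v) :: L)) * sg_mul_vert (R := R) v
  | succ p ih =>
    have hL : lng (lab u (ng v) :: L) = lab u v :: lng L := by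
      rw [h u v (.refl u) (.refl v), lng_cons, lneg_lneg]
    rw [chn_succ, chn_succ, tcobd, tcobd, ← neg_neg (cobd _ (ng v)), ← cobd_ng,
      cobd_congr fun y hy => ih (fun a b ha hb => h a b ha (hb.trans hy)) _, cobd_sg_mul,
      cobd_congr fun y hy => ih (fun a b ha hb => h a b (ha.trans hy) hb) _, cobd_mul_left, hL]
    ring

/-- The sign `(-1) ^ (dim u * dim v)`. -/
def rho (R : Type*) [CommRing R] (u v : List ℤ) : R := if sg ℤ u = 1 then 1 else sg R v

lemma sg_int (u : List ℤ) : sg ℤ u = 1 ∨ sg ℤ u = -1 := by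
  induction u with
  | nil => exact .inl rfl
  | cons c u ih =>
    by_cases hc : Odd c <;> rcases ih with ih | ih <;> simp [sg, par, hc, ih]

lemma sg_cases (u : List ℤ) :
    (sg ℤ u = 1 ∧ sg R u = 1) ∨ (sg ℤ u = -1 ∧ sg R u = -1) := by
  have h : ((sg ℤ u : ℤ) : R) = sg R u := sg_ringHom (Int.castRingHom R) u
  rcases sg_int u with h1 | h1
  · exact .inl ⟨h1, by rw [← h, h1, Int.cast_one]⟩
  · exact .inr ⟨h1, by rw [← h, h1, Int.cast_neg, Int.cast_one]⟩

lemma rho_symm (u v : List ℤ) : rho R u v = rho R v u := by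
  rcases sg_cases (R := R) u with ⟨h1, h2⟩ | ⟨h1, h2⟩ <;>
  rcases sg_cases (R := R) v with ⟨h3, h4⟩ | ⟨h3, h4⟩ <;> simp [rho, h1, h2, h3, h4]

lemma cobd_rho_mul (u v : List ℤ) (g : List ℤ → R) :
    cobd (fun b => rho R u b * g b) v = rho R u v * (sg R u * cobd g v) := by
  rcases sg_cases (R := R) u with ⟨h1, h2⟩ | ⟨h1, h2⟩
  · simp [rho, h1, h2]
  · simp [rho, h1, h2, cobd_sg_mul]

lemma chn_swap {u v : List ℤ} (h : ∀ a b, Face a u → Face b v → lab b a = lab a b)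
    (φ : List (Lab m) → R) (p : ℕ) (L : List (Lab m)) :
    chn lab φ p v u L = rho R u v * chn lab φ p u v L := by
  induction p generalizing u v L with
  | zero =>
    have hv : rho R u v * vert R v = vert R v := by
      unfold rho; split_ifs
      · rw [one_mul]
      · exact sg_mul_vert v
    rw [chn, chn, h u v (.refl u) (.refl v)]
    linear_combination -(vert R u * φ (lab u v :: L)) * hv
  | succ p ih =>
    rw [chn_succ, chn_succ, tcobd, tcobd, h u v (.refl u) (.refl v),
      cobd_congr fun y hy => ih (fun a b ha hb => h a b ha (hb.trans hy)) _, cobd_rho_mul,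
      cobd_congr fun y hy => (ih (fun a b ha hb => h a b (ha.trans hy) hb) _).trans
        (congrArg (· * _) (rho_symm y v)), cobd_rho_mul, rho_symm v u]
    linear_combination (rho R u v * cobd (fun w => chn lab φ p w v (lab u v :: L)) u)
      * sg_mul_self (R := R) v

end Chains
/-! ### Fundamental chains of cubes, their boundaries and hemispheres -/

section Functionals

variable {R : Type*} [CommRing R]

/-- Restriction of a cochain to the cells with first entry `c`. -/
def consL (R : Type*) [CommRing R] (c : ℤ) : (List ℤ → R) →ₗ[R] (List ℤ → R) :=
  LinearMap.funLeft R R (List.cons c)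

/-- Sum over the top cells of the cube `[-2k, 2k]^d`. -/
def cube (R : Type*) [CommRing R] (k : ℕ) : ℕ → (List ℤ → R) →ₗ[R] R
  | 0 => LinearMap.proj []
  | d + 1 => ∑ i ∈ Finset.range k,
      (cube R k d ∘ₗ consL R (2 * i + 1) + cube R k d ∘ₗ consL R (-(2 * i + 1)))

/-- Signed sum over the top cells of the boundary of `[-2k, 2k]^d`. -/
def sphere (R : Type*) [CommRing R] (k : ℕ) : ℕ → (List ℤ → R) →ₗ[R] R
  | 0 => 0
  | d + 1 => cube R k d ∘ₗ consL R (2 * k) - cube R k d ∘ₗ consL R (-(2 * k))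
      - ∑ i ∈ Finset.range k,
        (sphere R k d ∘ₗ consL R (2 * i + 1) + sphere R k d ∘ₗ consL R (-(2 * i + 1)))

/-- Signed sum over the top cells of the upper half of the boundary of `[-2k, 2k]^d`. -/
def hemi (R : Type*) [CommRing R] (k : ℕ) : ℕ → (List ℤ → R) →ₗ[R] R
  | 0 => 0
  | d + 1 => cube R k d ∘ₗ consL R (2 * k)
      - ∑ i ∈ Finset.range k, sphere R k d ∘ₗ consL R (2 * i + 1)

variable {k : ℕ}

lemma cube_zero (f : List ℤ → R) : cube R k 0 f = f [] := rfl

lemma cube_succ (d : ℕ) (f : List ℤ → R) : cube R k (d + 1) f = ∑ i ∈ Finset.range k,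
    (cube R k d (fun w => f ((2 * i + 1) :: w)) + cube R k d (fun w => f (-(2 * i + 1) :: w))) := by
  simp [cube, consL, LinearMap.sum_apply]; rfl

lemma sphere_zero (f : List ℤ → R) : sphere R k 0 f = 0 := rfl

lemma sphere_succ (d : ℕ) (f : List ℤ → R) : sphere R k (d + 1) f =
    cube R k d (fun w => f ((2 * k) :: w)) - cube R k d (fun w => f (-(2 * k) :: w))
    - ∑ i ∈ Finset.range k, (sphere R k d (fun w => f ((2 * i + 1) :: w))
      + sphere R k d (fun w => f (-(2 * i + 1) :: w))) := by
  simp [sphere, consL, LinearMap.sum_apply]; rfl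

lemma hemi_zero (f : List ℤ → R) : hemi R k 0 f = 0 := rfl

lemma hemi_succ (d : ℕ) (f : List ℤ → R) : hemi R k (d + 1) f =
    cube R k d (fun w => f ((2 * k) :: w))
    - ∑ i ∈ Finset.range k, sphere R k d (fun w => f ((2 * i + 1) :: w)) := by
  simp [hemi, consL, LinearMap.sum_apply]; rfl

lemma odd_pos_entry (i : ℕ) : Odd (2 * (i : ℤ) + 1) := odd_two_mul_add_one _

lemma odd_neg_entry (i : ℕ) : Odd (-(2 * (i : ℤ) + 1)) := (odd_two_mul_add_one _).neg

lemma not_odd_bd (j : ℕ) : ¬ Odd (2 * (j : ℤ)) := by simp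

lemma not_odd_neg_bd (j : ℕ) : ¬ Odd (-(2 * (j : ℤ))) := by simp

lemma cobd_fun_of_odd (f : List ℤ → R) {c : ℤ} (h : Odd c) :
    (fun w => cobd f (c :: w)) = (fun w => f ((c + 1) :: w)) - (fun w => f ((c - 1) :: w))
      - cobd (fun w => f (c :: w)) := by
  funext w; exact cobd_of_odd f h w

lemma cobd_fun_of_not_odd (f : List ℤ → R) {c : ℤ} (h : ¬ Odd c) :
    (fun w => cobd f (c :: w)) = cobd (fun w => f (c :: w)) := by
  funext w; exact cobd_of_not_odd f h w

lemma cube_cobd (d : ℕ) (f : List ℤ → R) : cube R k d (cobd f) = sphere R k d f := by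
  induction d generalizing f with
  | zero => rfl
  | succ d ih =>
    rw [cube_succ, sphere_succ]
    simp only [cobd_fun_of_odd _ (odd_pos_entry _), cobd_fun_of_odd _ (odd_neg_entry _), map_sub, ih]
    have := Finset.sum_range_sub (fun i : ℕ => cube R k d (fun w => f ((2 * i) :: w))
      - cube R k d (fun w => f (-(2 * i) :: w))) k
    simp only [Nat.cast_zero, mul_zero, neg_zero, sub_self, sub_zero] at this
    rw [← this, ← Finset.sum_sub_distrib]
    refine Finset.sum_congr rfl fun i _ => ?_
    rw [show (2 * (i : ℤ) + 1 + 1) = 2 * ((i + 1 : ℕ) : ℤ) by push_cast; ring,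
      show (2 * (i : ℤ) + 1 - 1) = 2 * (i : ℤ) by ring,
      show (-(2 * (i : ℤ) + 1) + 1) = -(2 * (i : ℤ)) by ring,
      show (-(2 * (i : ℤ) + 1) - 1) = -(2 * ((i + 1 : ℕ) : ℤ)) by push_cast; ring]
    ring

lemma sphere_cobd (d : ℕ) (f : List ℤ → R) : sphere R k d (cobd f) = 0 := by
  rw [← cube_cobd, show cobd (cobd f) = 0 from funext (cobd_cobd f), map_zero]

lemma hemi_cobd (d : ℕ) (f : List ℤ → R) :
    hemi R k (d + 1) (cobd f) = sphere R k d (fun w => f (0 :: w)) := by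
  rw [hemi_succ]
  simp only [cobd_fun_of_odd _ (odd_pos_entry _), cobd_fun_of_not_odd _ (not_odd_bd _), map_sub,
    cube_cobd, sphere_cobd, sub_zero]
  have := Finset.sum_range_sub (fun i : ℕ => sphere R k d (fun w => f ((2 * i) :: w))) k
  simp only [Nat.cast_zero, mul_zero] at this
  have h2 : ∑ i ∈ Finset.range k, (sphere R k d (fun w => f ((2 * (i : ℤ) + 1 + 1) :: w))
      - sphere R k d (fun w => f ((2 * (i : ℤ) + 1 - 1) :: w))) =
      sphere R k d (fun w => f ((2 * k) :: w)) - sphere R k d (fun w => f (0 :: w)) := by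
    rw [← this]
    refine Finset.sum_congr rfl fun i _ => ?_
    rw [show (2 * (i : ℤ) + 1 + 1) = 2 * ((i + 1 : ℕ) : ℤ) by push_cast; ring,
      show (2 * (i : ℤ) + 1 - 1) = 2 * (i : ℤ) by ring]
  rw [h2]; ring

lemma ng_cons (c : ℤ) (u : List ℤ) : ng (c :: u) = -c :: ng u := rfl

lemma cube_ng (d : ℕ) (f : List ℤ → R) : cube R k d (fun w => f (ng w)) = cube R k d f := by
  induction d generalizing f with
  | zero => rfl
  | succ d ih =>
    rw [cube_succ, cube_succ]
    refine Finset.sum_congr rfl fun i _ => ?_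
    simp only [ng_cons, neg_neg]
    rw [ih (fun w => f (-(2 * i + 1) :: w)), ih (fun w => f ((2 * i + 1) :: w)), add_comm]

lemma sphere_ng (d : ℕ) (f : List ℤ → R) :
    sphere R k d (fun w => f (ng w)) = -sphere R k d f := by
  induction d generalizing f with
  | zero => simp [sphere_zero]
  | succ d ih =>
    have hc : ∀ c : ℤ, cube R k d (fun w => f (c :: ng w)) = cube R k d (fun w => f (c :: w)) :=
      fun c => cube_ng d fun w => f (c :: w)
    have hs : ∀ c : ℤ, sphere R k d (fun w => f (c :: ng w))
        = -sphere R k d (fun w => f (c :: w)) := fun c => ih fun w => f (c :: w)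
    rw [sphere_succ, sphere_succ]
    simp only [ng_cons, neg_neg, hs, hc, Finset.sum_add_distrib, Finset.sum_neg_distrib]
    ring

lemma sphere_eq_hemi (d : ℕ) (f : List ℤ → R) :
    sphere R k d f = hemi R k d f - hemi R k d (fun w => f (ng w)) := by
  cases d with
  | zero => simp [sphere_zero, hemi_zero]
  | succ d =>
    have hc : ∀ c : ℤ, cube R k d (fun w => f (c :: ng w)) = cube R k d (fun w => f (c :: w)) :=
      fun c => cube_ng d fun w => f (c :: w)
    have hs : ∀ c : ℤ, sphere R k d (fun w => f (c :: ng w))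
        = -sphere R k d (fun w => f (c :: w)) := fun c => sphere_ng d fun w => f (c :: w)
    rw [sphere_succ, hemi_succ, hemi_succ]
    simp only [ng_cons, hs, hc, Finset.sum_add_distrib, Finset.sum_neg_distrib]
    ring

lemma sum_linearMap {β ι : Type*} (Φ : (β → R) →ₗ[R] R) (s : Finset ι) (g : ι → β → R) :
    ∑ i ∈ s, Φ (g i) = Φ (fun v => ∑ i ∈ s, g i v) := by
  rw [← map_sum]; congr 1; funext v; simp

lemma add_linearMap {β : Type*} (Φ : (β → R) →ₗ[R] R) (g h : β → R) :
    Φ g + Φ h = Φ (fun v => g v + h v) := (map_add Φ g h).symm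

lemma sub_linearMap {β : Type*} (Φ : (β → R) →ₗ[R] R) (g h : β → R) :
    Φ g - Φ h = Φ (fun v => g v - h v) := (map_sub Φ g h).symm

lemma cube_linearMap {β : Type*} (Φ : (β → R) →ₗ[R] R) (d : ℕ) (f : List ℤ → β → R) :
    cube R k d (fun w => Φ (f w)) = Φ (fun v => cube R k d (fun w => f w v)) := by
  induction d generalizing f with
  | zero => rfl
  | succ d ih => simp only [cube_succ, ih, sum_linearMap, add_linearMap]

lemma sphere_linearMap {β : Type*} (Φ : (β → R) →ₗ[R] R) (d : ℕ) (f : List ℤ → β → R) :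
    sphere R k d (fun w => Φ (f w)) = Φ (fun v => sphere R k d (fun w => f w v)) := by
  induction d generalizing f with
  | zero => exact (map_zero Φ).symm
  | succ d ih =>
    simp only [sphere_succ, ih, cube_linearMap, sum_linearMap, add_linearMap, sub_linearMap]

lemma hemi_linearMap {β : Type*} (Φ : (β → R) →ₗ[R] R) (d : ℕ) (f : List ℤ → β → R) :
    hemi R k d (fun w => Φ (f w)) = Φ (fun v => hemi R k d (fun w => f w v)) := by
  cases d with
  | zero => exact (map_zero Φ).symm
  | succ d =>
    simp only [hemi_succ, sphere_linearMap, cube_linearMap, sum_linearMap, sub_linearMap]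

section RingHom

variable {S : Type*} [CommRing S] (g : R →+* S)

lemma cube_ringHom (d : ℕ) (f : List ℤ → R) : cube S k d (fun w => g (f w)) = g (cube R k d f) := by
  induction d generalizing f with
  | zero => rfl
  | succ d ih =>
    simp only [cube_succ, map_sum, map_add, ih]

lemma sphere_ringHom (d : ℕ) (f : List ℤ → R) :
    sphere S k d (fun w => g (f w)) = g (sphere R k d f) := by
  induction d generalizing f with
  | zero => exact (map_zero g).symm
  | succ d ih =>
    simp only [sphere_succ, map_sum, map_add, map_sub, ih, cube_ringHom]

lemma hemi_ringHom (d : ℕ) (f : List ℤ → R) :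
    hemi S k d (fun w => g (f w)) = g (hemi R k d f) := by
  cases d with
  | zero => exact (map_zero g).symm
  | succ d =>
    simp only [hemi_succ, map_sum, map_sub, sphere_ringHom, cube_ringHom]

end RingHom

/-- The cells of the cube `[-2k, 2k]^d`. -/
def InBox (k d : ℕ) (u : List ℤ) : Prop := u.length = d ∧ ∀ c ∈ u, |c| ≤ 2 * k

/-- The cells of the boundary of the cube `[-2k, 2k]^d`. -/
def InBd (k d : ℕ) (u : List ℤ) : Prop := InBox k d u ∧ ∃ c ∈ u, |c| = 2 * k

lemma InBox.cons {d : ℕ} {u : List ℤ} (h : InBox k d u) {c : ℤ} (hc : |c| ≤ 2 * k) :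
    InBox k (d + 1) (c :: u) :=
  ⟨by simp [h.1], fun x hx => (List.mem_cons.1 hx).elim (fun e => e ▸ hc) (h.2 x)⟩

lemma InBd.cons {d : ℕ} {u : List ℤ} (h : InBd k d u) {c : ℤ} (hc : |c| ≤ 2 * k) :
    InBd k (d + 1) (c :: u) :=
  ⟨h.1.cons hc, h.2.imp fun _ h => ⟨List.mem_cons_of_mem _ h.1, h.2⟩⟩

lemma InBox.cons_bd {d : ℕ} {u : List ℤ} (h : InBox k d u) {c : ℤ} (hc : |c| = 2 * k) :
    InBd k (d + 1) (c :: u) :=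
  ⟨h.cons hc.le, c, List.mem_cons_self, hc⟩

lemma abs_entry_le {i : ℕ} (hi : i ∈ Finset.range k) : |2 * (i : ℤ) + 1| ≤ 2 * k := by
  rw [Finset.mem_range] at hi
  rw [abs_of_nonneg (by positivity)]; omega

lemma cube_congr {d : ℕ} {f g : List ℤ → R}
    (h : ∀ u, InBox k d u → sg ℤ u = (-1) ^ d → f u = g u) : cube R k d f = cube R k d g := by
  induction d generalizing f g with
  | zero => exact h [] ⟨rfl, by simp⟩ rfl
  | succ d ih =>
    rw [cube_succ, cube_succ]
    refine Finset.sum_congr rfl fun i hi => ?_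
    rw [ih fun u hu hs => h _ (hu.cons (abs_entry_le hi))
        (by rw [sg, par_of_odd (odd_pos_entry i), hs, pow_succ']),
      ih fun u hu hs => h _ (hu.cons (by rw [abs_neg]; exact abs_entry_le hi))
        (by rw [sg, par_of_odd (odd_neg_entry i), hs, pow_succ'])]

lemma abs_bd : |(2 * k : ℤ)| = 2 * k := abs_of_nonneg (by positivity)

lemma sphere_congr {d : ℕ} {f g : List ℤ → R}
    (h : ∀ u, InBd k d u → sg ℤ u = (-1) ^ (d + 1) → f u = g u) :
    sphere R k d f = sphere R k d g := by
  induction d generalizing f g with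
  | zero => rfl
  | succ d ih =>
    rw [sphere_succ, sphere_succ]
    rw [cube_congr fun u hu hs => h _ (hu.cons_bd abs_bd)
        (by rw [sg, par_of_not_odd (not_odd_bd k), hs]; ring),
      cube_congr fun u hu hs => h _ (hu.cons_bd ((abs_neg _).trans abs_bd))
        (by rw [sg, par_of_not_odd (not_odd_neg_bd k), hs]; ring)]
    congr 1
    refine Finset.sum_congr rfl fun i hi => ?_
    rw [ih fun u hu hs => h _ (hu.cons (abs_entry_le hi))
        (by rw [sg, par_of_odd (odd_pos_entry i), hs, pow_succ' _ (d + 1)]),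
      ih fun u hu hs => h _ (hu.cons (by rw [abs_neg]; exact abs_entry_le hi))
        (by rw [sg, par_of_odd (odd_neg_entry i), hs, pow_succ' _ (d + 1)])]

lemma hemi_congr {d : ℕ} {f g : List ℤ → R}
    (h : ∀ u, InBd k d u → sg ℤ u = (-1) ^ (d + 1) → f u = g u) :
    hemi R k d f = hemi R k d g := by
  cases d with
  | zero => rfl
  | succ d =>
    rw [hemi_succ, hemi_succ]
    rw [cube_congr fun u hu hs => h _ (hu.cons_bd abs_bd)
        (by rw [sg, par_of_not_odd (not_odd_bd k), hs]; ring)]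
    congr 1
    refine Finset.sum_congr rfl fun i hi => ?_
    rw [sphere_congr fun u hu hs => h _ (hu.cons (abs_entry_le hi))
        (by rw [sg, par_of_odd (odd_pos_entry i), hs, pow_succ' _ (d + 1)])]

/-- The functional `hemi` on the subspace where the first `j` coordinates vanish. -/
def hemiZ (R : Type*) [CommRing R] (k j d : ℕ) : (List ℤ → R) →ₗ[R] R :=
  hemi R k d ∘ₗ LinearMap.funLeft R R (fun w => List.replicate j 0 ++ w)

lemma hemiZ_apply (j d : ℕ) (f : List ℤ → R) :
    hemiZ R k j d f = hemi R k d (fun w => f (List.replicate j 0 ++ w)) := rfl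

lemma hemiZ_zero_left (d : ℕ) : hemiZ R k 0 d = hemi R k d := rfl

lemma hemiZ_zero_right (j : ℕ) (f : List ℤ → R) : hemiZ R k j 0 f = 0 := rfl

lemma sg_replicate (j : ℕ) (u : List ℤ) : sg R (List.replicate j 0 ++ u) = sg R u := by
  induction j with
  | zero => rfl
  | succ j ih =>
    rw [List.replicate_succ, List.cons_append, sg, ih, par_of_not_odd (by decide), one_mul]

lemma InBd.replicate {d : ℕ} {u : List ℤ} (hu : InBd k d u) (j : ℕ) :
    InBd k (j + d) (List.replicate j 0 ++ u) := by
  induction j with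
  | zero => simpa using hu
  | succ j ih =>
    rw [show j + 1 + d = j + d + 1 by ring]
    exact ih.cons (by simp)

lemma hemiZ_congr {j d : ℕ} {f g : List ℤ → R}
    (h : ∀ u, InBd k (j + d) u → sg ℤ u = (-1) ^ (d + 1) → f u = g u) :
    hemiZ R k j d f = hemiZ R k j d g :=
  hemi_congr fun u hu hs => h _ (hu.replicate j) ((sg_replicate j u).trans hs)

lemma cobd_replicate (j : ℕ) (f : List ℤ → R) (w : List ℤ) :
    cobd f (List.replicate j 0 ++ w) = cobd (fun x => f (List.replicate j 0 ++ x)) w := by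
  induction j generalizing f with
  | zero => rfl
  | succ j ih =>
    simp only [List.replicate_succ, List.cons_append]
    rw [cobd_of_not_odd _ (by decide), ih]

lemma hemiZ_cobd (j d : ℕ) (f : List ℤ → R) : hemiZ R k j (d + 1) (cobd f) =
    hemiZ R k (j + 1) d f - hemiZ R k (j + 1) d (fun w => f (ng w)) := by
  have h1 : (fun w => cobd f (List.replicate j 0 ++ w))
      = cobd (fun x => f (List.replicate j 0 ++ x)) := funext (cobd_replicate j f)
  have h2 : ∀ w : List ℤ, List.replicate j 0 ++ 0 :: w = List.replicate (j + 1) 0 ++ w := by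
    intro w; rw [List.replicate_succ', List.append_assoc]; rfl
  have h3 : ∀ w : List ℤ, ng (List.replicate (j + 1) 0 ++ w) = List.replicate (j + 1) 0 ++ ng w := by
    intro w; simp [ng]
  rw [hemiZ_apply, h1, hemi_cobd, sphere_eq_hemi, hemiZ_apply, hemiZ_apply]
  simp only [h2, h3]

lemma hemiZ_linearMap {β : Type*} (Φ : (β → R) →ₗ[R] R) (j d : ℕ) (f : List ℤ → β → R) :
    hemiZ R k j d (fun w => Φ (f w)) = Φ (fun v => hemiZ R k j d (fun w => f w v)) :=
  hemi_linearMap Φ d _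

end Functionals
/-! ### Alternating lists of labels -/

section Alternating

variable {m : ℕ}

/-- A list of labels without complementary entries. -/
def NC (L : List (Lab m)) : Prop := ∀ a ∈ L, ∀ b ∈ L, a ≠ lneg b

/-- The lexicographic order on labels. -/
def lle (a b : Lab m) : Prop := toLex a ≤ toLex b

instance : DecidableRel (lle (m := m)) := fun a b => inferInstanceAs (Decidable (toLex a ≤ toLex b))

instance : Std.Total (lle (m := m)) := ⟨fun a b => le_total (toLex a) (toLex b)⟩

instance : IsTrans (Lab m) lle := ⟨fun a b c => le_trans (a := toLex a) (b := toLex b) (c := toLex c)⟩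

lemma lle_antisymm {a b : Lab m} (h : lle a b) (h' : lle b a) : a = b :=
  toLex_inj.1 (le_antisymm h h')

lemma lle_iff {a b : Lab m} : lle a b ↔ a.1 < b.1 ∨ a.1 = b.1 ∧ a.2 ≤ b.2 := by
  rw [lle, Prod.Lex.toLex_le_toLex]

/-- A list of labels, sorted. -/
def srt (L : List (Lab m)) : List (Lab m) := L.insertionSort lle

lemma srt_perm (L : List (Lab m)) : (srt L).Perm L := List.perm_insertionSort _ L

lemma srt_sorted (L : List (Lab m)) : (srt L).Pairwise lle := List.pairwise_insertionSort _ L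

lemma srt_eq_of_perm {L L' : List (Lab m)} (h : L.Perm L') : srt L = srt L' :=
  List.Perm.eq_of_pairwise (fun _ _ _ _ => lle_antisymm) (srt_sorted L) (srt_sorted L')
    ((srt_perm L).trans (h.trans (srt_perm L').symm))

lemma srt_of_sorted {L : List (Lab m)} (h : L.Pairwise lle) : srt L = L :=
  List.Pairwise.insertionSort_eq h

lemma srt_lng {L : List (Lab m)} (h : NC L) : srt (lng L) = lng (srt L) := by
  refine (List.map_insertionSort lle lle lneg L fun a ha b hb => ?_).symm
  have hab := h a ha b hb
  rw [lle_iff, lle_iff]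
  obtain ⟨a1, a2⟩ := a
  obtain ⟨b1, b2⟩ := b
  simp only [lneg, ne_eq, Prod.mk.injEq, not_and] at hab ⊢
  constructor <;> rintro (h | ⟨h, -⟩) <;> first | exact .inl h | skip
  all_goals
    refine .inr ⟨h, ?_⟩
    have := hab h
    revert this; cases a2 <;> cases b2 <;> simp

/-- Indicator of the lists whose signs alternate, beginning with `b`. -/
def alt : Bool → List (Lab m) → ZMod 2
  | _, [] => 1
  | b, x :: L => (if x.2 = b then 1 else 0) * alt (!b) L

lemma alt_lng (b : Bool) (L : List (Lab m)) : alt b (lng L) = alt (!b) L := by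
  induction L generalizing b with
  | nil => rfl
  | cons x L ih =>
    rw [lng_cons, alt, alt, ih, lneg]
    cases b <;> cases x.2 <;> rfl

lemma ldiff_alt (b : Bool) (L : List (Lab m)) (hL : L ≠ []) :
    ldiff (alt b) L = alt b L + alt (!b) L := by
  induction L generalizing b with
  | nil => exact absurd rfl hL
  | cons x L ih =>
    have h1 : ldiff (fun K => alt b (x :: K)) L = (if x.2 = b then 1 else 0) * ldiff (alt (!b)) L :=
      ldiff_mul_left _ _ _
    rw [ldiff, h1]
    rcases eq_or_ne L [] with rfl | hL
    · cases b <;> cases hx : x.2 <;> simp [ldiff, alt, hx]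
    · rw [ih _ hL, CharTwo.sub_eq_add, alt, alt, Bool.not_not]
      have h2 := CharTwo.add_self_eq_zero (alt b L)
      have h3 := CharTwo.add_self_eq_zero (alt (!b) L)
      cases b <;> cases x.2 <;>
        simp only [Bool.not_true, Bool.not_false, reduceCtorEq, if_true, if_false] at * <;>
        first | linear_combination h2 | linear_combination h3 | ring

lemma ldiff_perm {Λ : Type*} {φ : List Λ → ZMod 2} (hφ : ∀ K K', K.Perm K' → φ K = φ K')
    {L L' : List Λ} (h : L.Perm L') : ldiff φ L = ldiff φ L' := by
  induction h generalizing φ with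
  | nil => rfl
  | cons a hp ih =>
    rw [ldiff, ldiff, hφ _ _ hp, ih fun K K' hK => hφ _ _ (hK.cons a)]
  | swap a b L =>
    simp only [ldiff]
    rw [show (fun K => φ (a :: b :: K)) = fun K => φ (b :: a :: K) from
      funext fun K => hφ _ _ (.swap _ _ _)]
    simp only [CharTwo.sub_eq_add]; ring
  | trans _ _ ih1 ih2 => rw [ih1 hφ, ih2 hφ]

lemma ldiff_congr {R Λ : Type*} [CommRing R] {φ ψ : List Λ → R} {L : List Λ}
    (h : ∀ K, K.Sublist L → φ K = ψ K) : ldiff φ L = ldiff ψ L := by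
  induction L generalizing φ ψ with
  | nil => rfl
  | cons a L ih =>
    rw [ldiff, ldiff, h L (List.sublist_cons_self a L), ih fun K hK => h _ (hK.cons_cons a)]

/-- Indicator of the lists of labels whose sorted signs alternate, beginning with `+`. -/
def fan (L : List (Lab m)) : ZMod 2 := alt true (srt L)

lemma fan_perm (L L' : List (Lab m)) (h : L.Perm L') : fan L = fan L' := by
  rw [fan, fan, srt_eq_of_perm h]

lemma ldiff_fan {L : List (Lab m)} (h : NC L) (hL : L ≠ []) :
    ldiff fan L = fan L + fan (lng L) := by
  rw [ldiff_perm fan_perm (srt_perm L).symm,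
    ldiff_congr (ψ := alt true) fun K hK => by rw [fan, srt_of_sorted ((srt_sorted L).sublist hK)],
    ldiff_alt _ _ (fun e => hL (by simpa [e] using (srt_perm L).symm)), fan, fan, srt_lng h, alt_lng]

/-- The sign pattern of the full alternating list. -/
def pat (j : Fin m) : Bool := decide (Even j.val)

variable (m) in
/-- The full alternating list. -/
def full : List (Lab m) := List.ofFn fun j => (j, pat j)

lemma alt_ofFn (b : Bool) {n : ℕ} (f : Fin n → Lab m) :
    alt b (List.ofFn f) = if ∀ i, (f i).2 = (b == decide (Even i.val)) then 1 else 0 := by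
  induction n generalizing b with
  | zero => simp [alt]
  | succ n ih =>
    rw [List.ofFn_succ, alt, ih, ite_zero_mul_ite_zero, one_mul]
    refine if_congr ?_ rfl rfl
    rw [Fin.forall_fin_succ]
    refine and_congr (by simp) (forall_congr' fun i => ?_)
    simp only [Fin.val_succ, Nat.even_add_one, decide_not]
    generalize decide (Even i.val) = e
    cases b <;> cases e <;> simp

lemma full_sorted : (full m).Pairwise lle := by
  rw [full, List.pairwise_ofFn]
  intro i j hij
  exact lle_iff.2 (.inl hij)

lemma full_nodup : (full m).Nodup :=
  List.nodup_ofFn.2 fun _ _ h => congrArg Prod.fst h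

lemma mem_full {l : Lab m} : l ∈ full m ↔ l.2 = pat l.1 := by
  simp only [full, List.mem_ofFn]
  constructor
  · rintro ⟨j, rfl⟩; rfl
  · intro h; exact ⟨l.1, Prod.ext rfl h.symm⟩

lemma NC.perm {L L' : List (Lab m)} (h : NC L) (hp : L.Perm L') : NC L' :=
  fun a ha b hb => h a (hp.mem_iff.2 ha) b (hp.mem_iff.2 hb)

lemma fan_eq_ite {L : List (Lab m)} (h : NC L) (hL : L.length = m) :
    fan L = if L.Perm (full m) then 1 else 0 := by
  split_ifs with hp
  · rw [fan_perm _ _ hp, fan, srt_of_sorted full_sorted, full, alt_ofFn, if_pos]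
    intro i; simp [pat]
  · obtain ⟨S, hS⟩ : ∃ S, S = srt L := ⟨_, rfl⟩
    have hlen : S.length = m := by rw [hS, (srt_perm L).length_eq, hL]
    obtain ⟨f, rfl⟩ : ∃ f : Fin m → Lab m, S = List.ofFn f := by
      refine ⟨fun i => S[i.val]'(by omega), ?_⟩
      refine List.ext_getElem (by simp [hlen]) fun i _ _ => by simp
    have hN : NC (List.ofFn f) := hS ▸ h.perm (srt_perm L).symm
    have hs : (List.ofFn f).Pairwise lle := hS ▸ srt_sorted L
    rw [fan, ← hS, alt_ofFn, if_neg]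
    intro hf
    apply hp
    refine (srt_perm L).symm.trans ?_
    rw [← hS]
    have hmono : StrictMono fun i => (f i).1 := by
      cases m with
      | zero => exact fun i => i.elim0
      | succ m =>
        rw [Fin.strictMono_iff_lt_succ]
        intro i
        have h1 := List.pairwise_ofFn.1 hs (Fin.castSucc_lt_succ (i := i))
        rcases lle_iff.1 h1 with h1 | ⟨h1, -⟩
        · exact h1
        · refine absurd (Prod.ext h1 ?_ : f i.castSucc = lneg (f i.succ))
            (hN _ (List.mem_ofFn.2 ⟨i.castSucc, rfl⟩) _ (List.mem_ofFn.2 ⟨i.succ, rfl⟩))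
          have h2 := hf i.castSucc
          have h3 := hf i.succ
          simp only [Fin.val_succ, Nat.even_add_one, Fin.val_castSucc] at h2 h3
          change (f i.castSucc).2 = !(f i.succ).2
          rw [h2, h3]
          cases hd : decide (Even i.val) <;> simp_all
    have hid := hmono.eq_id
    have : f = fun j => (j, pat j) := by
      funext j
      refine Prod.ext (congrFun hid j) ?_
      rw [hf j]; simp [pat]
    rw [this]; rfl

/-- The signed count of full alternating lists. -/
def theta (L : List (Lab m)) : ℤ :=
  (Matrix.of fun i j : Fin m => if L[i.val]? = some (j, pat j) then (1 : ℤ) else 0).det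

lemma ldiff_eq_sum {R Λ : Type*} [CommRing R] (φ : List Λ → R) (L : List Λ) {n : ℕ}
    (hn : L.length = n) : ldiff φ L = ∑ i : Fin n, (-1) ^ i.val * φ (L.eraseIdx i.val) := by
  induction L generalizing φ n with
  | nil => subst hn; simp [ldiff]
  | cons a L ih =>
    subst hn
    rw [ldiff, ih _ rfl, List.length_cons, Fin.sum_univ_succ]
    simp [pow_succ, sub_eq_add_neg]

lemma theta_cast {L : List (Lab m)} (hL : L.length = m) :
    ((theta L : ℤ) : ZMod 2) = if L.Perm (full m) then 1 else 0 := by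
  obtain ⟨f, rfl⟩ : ∃ f : Fin m → Lab m, L = List.ofFn f := by
    refine ⟨fun i => L[i.val]'(by omega), ?_⟩
    refine List.ext_getElem (by simp [hL]) fun i _ _ => by simp
  have hM : theta (List.ofFn f)
      = (Matrix.of fun i j : Fin m => if f i = (j, pat j) then (1 : ℤ) else 0).det := by
    rw [theta]; congr 1; funext i j; simp
  rw [hM]
  by_cases hf : ∀ i, (f i).2 = pat (f i).1
  · by_cases hi : Function.Injective fun i => (f i).1
    · obtain ⟨σ, hσ⟩ : ∃ σ : Equiv.Perm (Fin m), ∀ i, σ i = (f i).1 :=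
        ⟨Equiv.ofBijective _ (Finite.injective_iff_bijective.1 hi), fun i => rfl⟩
      have hfσ : f = (fun j => (j, pat j)) ∘ σ := by
        funext i; exact Prod.ext (hσ i).symm (by rw [hf, ← hσ]; rfl)
      rw [if_pos (by rw [hfσ]; exact Equiv.Perm.ofFn_comp_perm σ _)]
      have : (Matrix.of fun i j : Fin m => if f i = (j, pat j) then (1 : ℤ) else 0)
          = Equiv.Perm.permMatrix ℤ σ := by
        ext i j
        simp only [Matrix.of_apply, Equiv.Perm.permMatrix, PEquiv.toMatrix_apply,
          Equiv.toPEquiv_apply, Option.mem_some_iff]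
        refine if_congr ?_ rfl rfl
        rw [hσ]
        exact ⟨fun h => by rw [h], fun h => Prod.ext h (by rw [hf, h])⟩
      rw [this, Matrix.det_permutation]
      rcases Int.units_eq_one_or (Equiv.Perm.sign σ) with h | h <;> rw [h] <;> decide
    · rw [if_neg]
      · simp only [Function.Injective, not_forall] at hi
        obtain ⟨i, j, hij, hne⟩ := hi
        rw [Matrix.det_zero_of_row_eq hne, Int.cast_zero]
        have : f i = f j := Prod.ext hij (by rw [hf, hf]; exact congrArg pat hij)
        funext k; simp [this]
      · intro hp
        apply hi
        have := List.nodup_ofFn.1 (hp.nodup_iff.2 full_nodup)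
        intro i j hij
        exact this (Prod.ext hij (by rw [hf, hf]; exact congrArg pat hij))
  · rw [if_neg fun hp => hf fun i => mem_full.1 (hp.mem_iff.1 (List.mem_ofFn.2 ⟨i, rfl⟩))]
    push Not at hf
    obtain ⟨i, hi⟩ := hf
    rw [Matrix.det_eq_zero_of_row_eq_zero i, Int.cast_zero]
    intro j
    rw [Matrix.of_apply, if_neg]
    intro h; exact hi (by rw [h])

lemma theta_cast_eq_fan {L : List (Lab m)} (h : NC L) (hL : L.length = m) :
    ((theta L : ℤ) : ZMod 2) = fan L := by
  rw [theta_cast hL, fan_eq_ite h hL]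

lemma ldiff_theta {L : List (Lab m)} (h : NC L) (hL : L.length = m + 1) :
    ldiff theta L = 0 := by
  obtain ⟨f, rfl⟩ : ∃ f : Fin (m + 1) → Lab m, L = List.ofFn f := by
    refine ⟨fun i => L[i.val]'(by omega), ?_⟩
    refine List.ext_getElem (by simp [hL]) fun i _ _ => by simp only [List.getElem_ofFn]
  let A : Matrix (Fin (m + 1)) (Fin (m + 1)) ℤ :=
    Matrix.of fun i => Fin.cons 1 fun j => if f i = (j, pat j) then 1 else 0
  have hA : ldiff theta (List.ofFn f) = A.det := by
    rw [ldiff_eq_sum _ _ hL, Matrix.det_succ_column_zero]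
    refine Finset.sum_congr rfl fun i _ => ?_
    rw [show A i 0 = 1 from rfl, mul_one, theta]
    congr 2
    ext r j
    have : ((List.ofFn f).eraseIdx i.val)[r.val]? = some (f (i.succAbove r)) := by
      rw [List.getElem?_eraseIdx]
      by_cases hri : r.val < i.val
      · rw [if_pos hri, Fin.succAbove_of_castSucc_lt _ _ (by exact hri),
          List.getElem?_eq_getElem (by rw [hL]; omega), List.getElem_ofFn]
        rfl
      · rw [if_neg hri, Fin.succAbove_of_le_castSucc _ _ (by simpa [Fin.le_def] using hri)]
        simp
    simp only [Matrix.of_apply, this, Option.some.injEq, A, Matrix.submatrix_apply, Fin.cons_succ]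
  rw [hA]
  by_cases hf : ∀ i, (f i).2 = pat (f i).1
  · obtain ⟨i, j, hne, hij⟩ := Fintype.exists_ne_map_eq_of_card_lt (fun i => (f i).1) (by simp)
    refine Matrix.det_zero_of_row_eq hne ?_
    have : f i = f j := Prod.ext hij (by rw [hf, hf]; exact congrArg pat hij)
    simp only [A]
    funext k; simp [this]
  · push Not at hf
    obtain ⟨i, hi⟩ := hf
    refine Matrix.det_eq_zero_of_column_eq_zero (f i).1.succ fun r => ?_
    simp only [A, Matrix.of_apply, Fin.cons_succ]
    rw [if_neg]
    intro hr
    refine h (f r) (List.mem_ofFn.2 ⟨r, rfl⟩) (f i) (List.mem_ofFn.2 ⟨i, rfl⟩) ?_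
    rw [hr, lneg]
    refine Prod.ext rfl ?_
    revert hi
    cases (f i).2 <;> cases pat (f i).1 <;> simp

end Alternating
/-! ### The combinatorial theorem -/

section Labelling

lemma Face.inBox {k d : ℕ} {y u : List ℤ} (h : Face y u) (hu : InBox k d u) : InBox k d y := by
  refine ⟨h.length_eq.trans hu.1, ?_⟩
  have h2 := hu.2
  clear hu
  induction h with
  | nil => simp
  | @cons a b _ _ hab _ ih =>
    intro c hc
    rcases List.mem_cons.1 hc with rfl | hc
    · have hb := h2 b List.mem_cons_self
      rcases hab with rfl | ⟨ho, hab⟩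
      · exact hb
      · obtain ⟨t, ht⟩ := ho
        rw [abs_le] at hb ⊢
        omega
    · exact ih (fun c hc => h2 c (List.mem_cons_of_mem _ hc)) c hc

lemma Face.inBd {k d : ℕ} {y u : List ℤ} (h : Face y u) (hu : InBd k d u) : InBd k d y := by
  refine ⟨h.inBox hu.1, ?_⟩
  have h2 := hu.2
  clear hu
  induction h with
  | nil => exact h2
  | @cons a b _ _ hab _ ih =>
    obtain ⟨c, hc, hck⟩ := h2
    rcases List.mem_cons.1 hc with rfl | hc
    · rcases hab with rfl | ⟨ho, -⟩
      · exact ⟨a, List.mem_cons_self, hck⟩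
      · exfalso
        obtain ⟨t, ht⟩ := ho
        rcases abs_cases c <;> omega
    · obtain ⟨c, hc, hck⟩ := ih ⟨c, hc, hck⟩
      exact ⟨c, List.mem_cons_of_mem _ hc, hck⟩

/-- An antipodal and symmetric labelling of (pairs of cells of) the cube `[-2k, 2k]^(n+1)` by
signed labels, without complementary labels on the faces of a cell. -/
structure IsLabelling (n k : ℕ) (lab : List ℤ → List ℤ → Lab (2 * n + 1)) : Prop where
  ng_left : ∀ u v, InBd k (n + 1) u → InBd k (n + 1) v → lab (ng u) v = lneg (lab u v)
  ng_right : ∀ u v, InBd k (n + 1) u → InBd k (n + 1) v → lab u (ng v) = lneg (lab u v)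
  swap : ∀ u v, InBd k (n + 1) u → InBd k (n + 1) v → lab v u = lab u v
  nc : ∀ u v, InBd k (n + 1) u → InBox k (n + 1) v → ∀ a a' b b', Face a u → Face a' u →
    Face b v → Face b' v → lab a b ≠ lneg (lab a' b')

variable {R : Type*} [CommRing R] {n k : ℕ} {lab : List ℤ → List ℤ → Lab (2 * n + 1)}

lemma IsLabelling.chn_congr (H : IsLabelling n k lab) {φ ψ : List (Lab (2 * n + 1)) → R} {p : ℕ}
    {u v : List ℤ} (hu : InBd k (n + 1) u) (hv : InBox k (n + 1) v) {y z : List ℤ}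
    (hy : Face y u) (hz : Face z v) {L : List (Lab (2 * n + 1))}
    (hL : ∀ l ∈ L, ∃ a b, Face a u ∧ Face b v ∧ l = lab a b)
    (h : ∀ K : List (Lab (2 * n + 1)), NC K → K.length = p + 1 + L.length → φ K = ψ K) :
    chn lab φ p y z L = chn lab ψ p y z L := by
  refine CubicalFan.chn_congr lab (fun l => ∃ a b, Face a u ∧ Face b v ∧ l = lab a b) p y z L
    (fun a b ha hb => ⟨a, b, ha.trans hy, hb.trans hz, rfl⟩) hL fun K hK hP => h K ?_ hK
  intro l hl l' hl'
  obtain ⟨a, b, ha, hb, rfl⟩ := hP l hl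
  obtain ⟨a', b', ha', hb', rfl⟩ := hP l' hl'
  exact H.nc u v hu hv a a' b b' ha ha' hb hb'

lemma IsLabelling.chn_ng_left (H : IsLabelling n k lab) {u v : List ℤ} (hu : InBd k (n + 1) u)
    (hv : InBd k (n + 1) v) (φ : List (Lab (2 * n + 1)) → R) (p : ℕ)
    (L : List (Lab (2 * n + 1))) :
    chn lab φ p (ng u) v L = sg R u * chn lab (fun K => φ (lng K)) p u v (lng L) :=
  CubicalFan.chn_ng_left (fun _ _ ha hb => H.ng_left _ _ (ha.inBd hu) (hb.inBd hv)) φ p L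

lemma IsLabelling.chn_ng_right (H : IsLabelling n k lab) {u v : List ℤ} (hu : InBd k (n + 1) u)
    (hv : InBd k (n + 1) v) (φ : List (Lab (2 * n + 1)) → R) (p : ℕ)
    (L : List (Lab (2 * n + 1))) :
    chn lab φ p u (ng v) L = sg R v * chn lab (fun K => φ (lng K)) p u v (lng L) :=
  CubicalFan.chn_ng_right (fun _ _ ha hb => H.ng_right _ _ (ha.inBd hu) (hb.inBd hv)) φ p L

/-- One half of the symmetric expression `chn_succ_eq` for `chn`. -/
def halfChn (lab : List ℤ → List ℤ → Lab (2 * n + 1)) (φ : List (Lab (2 * n + 1)) → R) (p : ℕ)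
    (L : List (Lab (2 * n + 1))) (u v : List ℤ) : R :=
  cobd (fun a => chn lab φ p a v (lab u v :: L)) u

lemma IsLabelling.chn_succ_eq (H : IsLabelling n k lab) {u v : List ℤ} (hu : InBd k (n + 1) u)
    (hv : InBd k (n + 1) v) (hs : sg R u = 1) (hr : ∀ b, rho R u b = 1)
    (φ : List (Lab (2 * n + 1)) → R) (p : ℕ) (L : List (Lab (2 * n + 1))) :
    chn lab φ (p + 1) u v L = halfChn lab φ p L u v + halfChn lab φ p L v u := by
  rw [chn_succ, tcobd, hs, one_mul, halfChn, halfChn, H.swap u v hu hv]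
  congr 1
  refine cobd_congr fun b hb => ?_
  rw [chn_swap (lab := lab) (u := b) (v := u)
    (fun x y hx hy => H.swap x y (hx.inBd (hb.inBd hv)) (hy.inBd hu)) φ p, rho_symm, hr, one_mul]

/-- The product of two functionals `hemiZ`. -/
def hh (R : Type*) [CommRing R] (k j₁ d₁ j₂ d₂ : ℕ) (f : List ℤ → List ℤ → R) : R :=
  hemiZ R k j₁ d₁ fun u => hemiZ R k j₂ d₂ (f u)

variable {j₁ d₁ j₂ d₂ : ℕ}

lemma hh_add (f g : List ℤ → List ℤ → R) :
    hh R k j₁ d₁ j₂ d₂ (fun u v => f u v + g u v)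
      = hh R k j₁ d₁ j₂ d₂ f + hh R k j₁ d₁ j₂ d₂ g := by
  simp only [hh, add_linearMap]

lemma hh_sub (f g : List ℤ → List ℤ → R) :
    hh R k j₁ d₁ j₂ d₂ (fun u v => f u v - g u v)
      = hh R k j₁ d₁ j₂ d₂ f - hh R k j₁ d₁ j₂ d₂ g := by
  simp only [hh, sub_linearMap]

lemma hh_congr {f g : List ℤ → List ℤ → R}
    (h : ∀ u v, InBd k (j₁ + d₁) u → InBd k (j₂ + d₂) v → sg ℤ u = (-1) ^ (d₁ + 1) →
      sg ℤ v = (-1) ^ (d₂ + 1) → f u v = g u v) :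
    hh R k j₁ d₁ j₂ d₂ f = hh R k j₁ d₁ j₂ d₂ g :=
  hemiZ_congr fun u hu hsu => hemiZ_congr fun v hv hsv => h u v hu hv hsu hsv

lemma hh_cobd_left (f : List ℤ → List ℤ → R) :
    hh R k j₁ (d₁ + 1) j₂ d₂ (fun u v => cobd (fun a => f a v) u) =
      hh R k (j₁ + 1) d₁ j₂ d₂ f - hh R k (j₁ + 1) d₁ j₂ d₂ (fun u v => f (ng u) v) := by
  have : (fun u => hemiZ R k j₂ d₂ fun v => cobd (fun a => f a v) u)
      = cobd (fun u => hemiZ R k j₂ d₂ (f u)) := by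
    funext u; rw [cobd_linearMap]
  rw [hh, this, hemiZ_cobd]; rfl

lemma hh_cobd_right (f : List ℤ → List ℤ → R) :
    hh R k j₁ d₁ j₂ (d₂ + 1) (fun u v => cobd (f u) v) =
      hh R k j₁ d₁ (j₂ + 1) d₂ f - hh R k j₁ d₁ (j₂ + 1) d₂ (fun u v => f u (ng v)) := by
  rw [← hh_sub, hh, hh]
  congr 1; funext u
  rw [show (fun v => cobd (f u) v) = cobd (f u) from rfl, hemiZ_cobd, sub_linearMap]

lemma hh_swap (f : List ℤ → List ℤ → R) :
    hh R k j₁ d₁ j₁ d₁ (fun u v => f v u) = hh R k j₁ d₁ j₁ d₁ f := by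
  rw [hh, hh, hemiZ_linearMap (hemiZ R k j₁ d₁) j₁ d₁ (fun u v => f v u)]

lemma hh_ringHom {S : Type*} [CommRing S] (g : R →+* S) (f : List ℤ → List ℤ → R) :
    hh S k j₁ d₁ j₂ d₂ (fun u v => g (f u v)) = g (hh R k j₁ d₁ j₂ d₂ f) := by
  simp only [hh, hemiZ_apply, ← hemi_ringHom]

lemma sg_two (u : List ℤ) : sg (ZMod 2) u = 1 := by
  rcases sg_cases (R := ZMod 2) u with ⟨-, h⟩ | ⟨-, h⟩ <;> rw [h]; decide

lemma neg_one_pow_two (p : ℕ) : (-1 : ZMod 2) ^ p = 1 := by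
  rw [show (-1 : ZMod 2) = 1 by decide, one_pow]

lemma rho_two (u v : List ℤ) : rho (ZMod 2) u v = 1 := by
  simp [rho, sg_two]

/-- The cochain `fan` with opposite signs. -/
def fanN {m : ℕ} (L : List (Lab m)) : ZMod 2 := fan (lng L)

lemma IsLabelling.fan_add (H : IsLabelling n k lab) {p : ℕ} {u v : List ℤ}
    (hu : InBd k (n + 1) u) (hv : InBox k (n + 1) v) {y z : List ℤ}
    (hy : Face y u) (hz : Face z v) {L : List (Lab (2 * n + 1))}
    (hL : ∀ l ∈ L, ∃ a b, Face a u ∧ Face b v ∧ l = lab a b) :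
    chn lab fan p y z L + chn lab fanN p y z L
      = bchn lab fan p y z L - ldiff (chn lab fan p y z) L := by
  rw [← chn_add, ← one_mul (bchn _ _ _ _ _ _ - _), ← neg_one_pow_two p, ← chn_ldiff]
  refine (H.chn_congr hu hv hy hz hL fun K hK hlen => ldiff_fan hK ?_).symm
  rintro rfl
  rw [List.length_nil] at hlen
  omega

lemma IsLabelling.hh_fan (H : IsLabelling n k lab) (p i j : ℕ) (hp : i + j = p) (hi : i ≤ n)
    (hj : j ≤ n) :
    hh (ZMod 2) k (n - i) (i + 1) (n - j) (j + 1)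
      (fun u v => chn lab fan p u v [] + chn lab fanN p u v []) = (p.choose i : ZMod 2) := by
  induction p generalizing i j with
  | zero =>
    obtain rfl : i = 0 := by omega
    obtain rfl : j = 0 := by omega
    have h1 : ∀ f : List ℤ → ZMod 2, hemiZ (ZMod 2) k n 1 f =
        f (List.replicate n 0 ++ [2 * (k : ℤ)]) := by
      intro f
      rw [hemiZ_apply, hemi_succ, cube_zero]
      simp [sphere_zero]
    have h2 : vert (ZMod 2) (List.replicate n 0 ++ [2 * (k : ℤ)]) = 1 := by
      have : ∀ j : ℕ, vert (ZMod 2) (List.replicate j 0 ++ [2 * (k : ℤ)]) = 1 := by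
        intro j
        induction j with
        | zero => simp [vert]
        | succ j ih => rw [List.replicate_succ, List.cons_append, vert, ih]; simp
      exact this n
    rw [hh_congr (g := fun u v => vert (ZMod 2) u * vert (ZMod 2) v)]
    · rw [hh, Nat.sub_zero, h1, h1, h2]; simp
    · intro u v hu hv _ _
      rw [Nat.sub_zero] at hu hv
      rw [H.fan_add hu hv.1 (.refl u) (.refl v) (by simp), bchn, ldiff]
      simp [fan, srt, alt]
  | succ p ih =>
    rw [hh_congr (g := fun u v => cobd (fun a => chn lab fan p a v []) u
      + cobd (fun b => chn lab fan p u b []) v), hh_add, hh_cobd_left, hh_cobd_right]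
    rotate_left
    · intro u v hu hv _ _
      rw [show n - i + (i + 1) = n + 1 by omega] at hu
      rw [show n - j + (j + 1) = n + 1 by omega] at hv
      rw [H.fan_add hu hv.1 (.refl u) (.refl v) (by simp), bchn, ldiff, tcobd, sg_two]
      ring
    have hl : hh (ZMod 2) k (n - i + 1) i (n - j) (j + 1) (fun u v => chn lab fan p u v [])
        - hh (ZMod 2) k (n - i + 1) i (n - j) (j + 1) (fun u v => chn lab fan p (ng u) v [])
        = hh (ZMod 2) k (n - i + 1) i (n - j) (j + 1)
          (fun u v => chn lab fan p u v [] + chn lab fanN p u v []) := by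
      rw [hh_add, CharTwo.sub_eq_add]
      congr 1
      refine hh_congr fun u v hu hv _ _ => ?_
      rw [show n - i + 1 + i = n + 1 by omega] at hu
      rw [show n - j + (j + 1) = n + 1 by omega] at hv
      rw [H.chn_ng_left hu hv, sg_two, one_mul]; rfl
    have hr : hh (ZMod 2) k (n - i) (i + 1) (n - j + 1) j (fun u v => chn lab fan p u v [])
        - hh (ZMod 2) k (n - i) (i + 1) (n - j + 1) j (fun u v => chn lab fan p u (ng v) [])
        = hh (ZMod 2) k (n - i) (i + 1) (n - j + 1) j
          (fun u v => chn lab fan p u v [] + chn lab fanN p u v []) := by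
      rw [hh_add, CharTwo.sub_eq_add]
      congr 1
      refine hh_congr fun u v hu hv _ _ => ?_
      rw [show n - i + (i + 1) = n + 1 by omega] at hu
      rw [show n - j + 1 + j = n + 1 by omega] at hv
      rw [H.chn_ng_right hu hv, sg_two, one_mul]; rfl
    rw [hl, hr]
    have hz1 : ∀ (a b c : ℕ) (f : List ℤ → List ℤ → ZMod 2), hh (ZMod 2) k a 0 b c f = 0 :=
      fun _ _ _ _ => hemiZ_zero_right _ _
    have hz2 : ∀ (a b c : ℕ) (f : List ℤ → List ℤ → ZMod 2), hh (ZMod 2) k a b c 0 f = 0 :=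
      fun _ _ _ _ => by
        simp only [hh, hemiZ_zero_right]
        exact map_zero (hemiZ (ZMod 2) k _ _)
    rcases i with _ | i
    · rcases j with _ | j
      · omega
      · rw [hz1, show n - (j + 1) + 1 = n - j by omega, ih 0 j (by omega) (by omega) (by omega)]
        simp
    · rw [show n - (i + 1) + 1 = n - i by omega, ih i j (by omega) (by omega) hj,
        Nat.choose_succ_succ, Nat.cast_add]
      congr 1
      rcases j with _ | j
      · rw [hz2, Nat.choose_eq_zero_of_lt (by omega), Nat.cast_zero]
      · rw [show n - (j + 1) + 1 = n - j by omega, ih (i + 1) j (by omega) hi (by omega)]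

lemma IsLabelling.sphere_sphere (H : IsLabelling n k lab) (hn : Even n) :
    sphere ℤ k (n + 1) (fun u => sphere ℤ k (n + 1) fun v => chn lab theta (2 * n) u v []) = 0 := by
  have h : ∀ u, InBd k (n + 1) u → sg ℤ u = (-1) ^ (n + 1 + 1) →
      sphere ℤ k (n + 1) (fun v => chn lab theta (2 * n) u v [])
        = cobd (fun a => -cube ℤ k (n + 1) fun v => chn lab theta (2 * n) a v []) u := by
    intro u hu hs
    have hs1 : sg ℤ u = 1 := by rw [hs, hn.add_one.add_one.neg_one_pow]
    rw [← cube_cobd, cobd_neg, cobd_linearMap, ← map_neg]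
    refine cube_congr fun v hv _ => ?_
    have h0 : tcobd (fun a b => chn lab theta (2 * n) a b []) u v = 0 := by
      have h1 := chn_ldiff lab theta (2 * n + 1) u v []
      rw [H.chn_congr (ψ := fun _ => 0) hu hv (.refl u) (.refl v) (by simp)
        fun K hK hlen => ldiff_theta hK hlen, chn_zero, ldiff, bchn, sub_zero] at h1
      simpa [pow_succ] using h1.symm
    rw [tcobd, hs1, one_mul] at h0
    rw [Pi.neg_apply]
    linarith
  rw [sphere_congr h]
  exact sphere_cobd (n + 1) (fun a => -cube ℤ k (n + 1) fun v => chn lab theta (2 * n) a v [])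

lemma IsLabelling.false (H : IsLabelling n k lab) (hn : Even n) (hn2 : 2 ≤ n)
    (hch : Odd ((2 * n - 1).choose (n - 1))) : False := by
  have hpow : (-1 : ℤ) ^ (n + 1 + 1) = 1 := hn.add_one.add_one.neg_one_pow
  -- antipodal symmetry
  have e1 : hh ℤ k 0 (n + 1) 0 (n + 1) (fun u v => chn lab theta (2 * n) u v [])
      = hh ℤ k 0 (n + 1) 0 (n + 1)
        (fun u v => chn lab (fun K => theta (lng K)) (2 * n) u v []) := by
    have h0 := H.sphere_sphere hn
    have h1 : sphere ℤ k (n + 1)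
          (fun u => sphere ℤ k (n + 1) fun v => chn lab theta (2 * n) u v [])
        = hh ℤ k 0 (n + 1) 0 (n + 1) (fun u v => chn lab theta (2 * n) u v [])
          - hh ℤ k 0 (n + 1) 0 (n + 1) (fun u v => chn lab theta (2 * n) u (ng v) [])
          - (hh ℤ k 0 (n + 1) 0 (n + 1) (fun u v => chn lab theta (2 * n) (ng u) v [])
          - hh ℤ k 0 (n + 1) 0 (n + 1) (fun u v => chn lab theta (2 * n) (ng u) (ng v) [])) := by
      rw [← hh_sub, ← hh_sub]
      simp only [sphere_eq_hemi, hh, hemiZ_zero_left, sub_linearMap]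
    rw [h1, hh_congr (f := fun u v => chn lab theta (2 * n) u (ng v) [])
        (g := fun u v => chn lab (fun K => theta (lng K)) (2 * n) u v []),
      hh_congr (f := fun u v => chn lab theta (2 * n) (ng u) v [])
        (g := fun u v => chn lab (fun K => theta (lng K)) (2 * n) u v []),
      hh_congr (f := fun u v => chn lab theta (2 * n) (ng u) (ng v) [])
        (g := fun u v => chn lab theta (2 * n) u v [])] at h0
    · linarith
    all_goals
      intro u v hu hv hsu hsv
      rw [zero_add] at hu hv
      rw [hpow] at hsu hsv
    · rw [← sg_ng] at hsu
      have hnu : InBd k (n + 1) (ng u) := by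
        refine ⟨⟨by simpa [ng] using hu.1.1, ?_⟩, ?_⟩
        · intro c hc
          obtain ⟨x, hx, rfl⟩ := List.mem_map.1 hc
          rw [abs_neg]; exact hu.1.2 x hx
        · obtain ⟨x, hx, hxk⟩ := hu.2
          exact ⟨-x, List.mem_map.2 ⟨x, hx, rfl⟩, by rw [abs_neg, hxk]⟩
      rw [H.chn_ng_right hnu hv, H.chn_ng_left hu hv, hsv, ← sg_ng, hsu]
      simp only [one_mul, lng_nil, lng_lng]
    · rw [H.chn_ng_left hu hv, hsu, one_mul]; rfl
    · rw [H.chn_ng_right hu hv, hsv, one_mul]; rfl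
  -- symmetry under exchange of the factors
  have e2 : ∀ φ : List (Lab (2 * n + 1)) → ℤ,
      hh ℤ k 0 (n + 1) 0 (n + 1) (fun u v => chn lab φ (2 * n) u v [])
      = 2 * hh ℤ k 0 (n + 1) 0 (n + 1) (halfChn lab φ (2 * n - 1) []) := by
    intro φ
    rw [hh_congr (g := fun u v => halfChn lab φ (2 * n - 1) [] u v
      + halfChn lab φ (2 * n - 1) [] v u), hh_add]
    · exact (congrArg _ (hh_swap _)).trans (two_mul _).symm
    intro u v hu hv hsu _
    rw [zero_add] at hu hv
    rw [hpow] at hsu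
    have := H.chn_succ_eq hu hv hsu (fun b => by rw [rho, if_pos hsu]) φ (2 * n - 1) []
    rwa [show 2 * n - 1 + 1 = 2 * n by omega] at this
  rw [e2, e2] at e1
  have e3 : hh ℤ k 0 (n + 1) 0 (n + 1) (halfChn lab theta (2 * n - 1) [])
      = hh ℤ k 0 (n + 1) 0 (n + 1) (halfChn lab (fun K => theta (lng K)) (2 * n - 1) []) := by
    linarith
  -- reduction modulo two
  have e4 : hh (ZMod 2) k 0 (n + 1) 0 (n + 1) (halfChn lab fan (2 * n - 1) [])
      = hh (ZMod 2) k 0 (n + 1) 0 (n + 1) (halfChn lab fanN (2 * n - 1) []) := by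
    have h := congrArg (Int.castRingHom (ZMod 2)) e3
    rw [← hh_ringHom, ← hh_ringHom] at h
    rw [hh_congr (g := fun u v => Int.castRingHom (ZMod 2) (halfChn lab theta (2 * n - 1) [] u v)),
      h]
    · refine hh_congr fun u v hu hv _ _ => ?_
      rw [zero_add] at hu hv
      simp only [halfChn]
      rw [← cobd_ringHom]
      refine cobd_congr fun y hy => ?_
      rw [← chn_ringHom]
      refine H.chn_congr hu hv.1 hy (.refl v)
        (by simpa using ⟨u, .refl u, v, .refl v, rfl⟩) fun K hK hlen => ?_
      refine theta_cast_eq_fan ?_ (by simp [lng, hlen]; omega)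
      intro a ha b hb hab
      obtain ⟨a', ha', rfl⟩ := List.mem_map.1 ha
      obtain ⟨b', hb', rfl⟩ := List.mem_map.1 hb
      exact hK a' ha' b' hb' (by simpa using congrArg lneg hab)
    · intro u v hu hv _ _
      rw [zero_add] at hu hv
      simp only [halfChn]
      rw [← cobd_ringHom]
      refine cobd_congr fun y hy => ?_
      rw [← chn_ringHom]
      refine H.chn_congr hu hv.1 hy (.refl v)
        (by simpa using ⟨u, .refl u, v, .refl v, rfl⟩) fun K hK hlen => ?_
      exact (theta_cast_eq_fan hK (by simp [hlen]; omega)).symm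
  obtain ⟨p, hp⟩ : ∃ p, 2 * n - 1 = p + 1 + 1 := ⟨2 * n - 3, by omega⟩
  -- the defect between the two halves
  let W : List ℤ → List ℤ → ZMod 2 := fun u v =>
    cobd (fun a => cobd (fun b => halfChn lab fan p [lab u v] a b) v) u
  have e5 : hh (ZMod 2) k 0 (n + 1) 0 (n + 1) (fun u v => halfChn lab fan (2 * n - 1) [] u v
      + halfChn lab fanN (2 * n - 1) [] u v)
      = hh (ZMod 2) k 0 (n + 1) 0 (n + 1) (fun u v => W u v + W v u
        + cobd (fun a => chn lab fan (2 * n - 1) a v []) u) := by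
    refine hh_congr fun u v hu hv _ _ => ?_
    rw [zero_add] at hu hv
    have h1 : W v u = cobd (fun a => cobd (fun b => halfChn lab fan p [lab u v] b a) v) u := by
      simp only [W]
      rw [cobd_comm, H.swap u v hu hv]
    have h2 : cobd (fun a => cobd (fun w => chn lab fan (p + 1) w v [lab u v]) a) u = 0 :=
      cobd_cobd _ u
    simp only [halfChn]
    rw [← cobd_add, h1]
    simp only [W]
    rw [← add_zero (cobd _ u + cobd _ u), ← h2, ← cobd_add, ← cobd_add, ← cobd_add]
    refine cobd_congr fun y hy => ?_
    rw [H.fan_add hu hv.1 hy (.refl v) (by simpa using ⟨u, .refl u, v, .refl v, rfl⟩), hp, bchn,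
      tcobd, sg_two, one_mul, ldiff, ldiff, sub_zero, CharTwo.sub_eq_add]
    congr 1
    rw [add_comm]
    congr 1
    rw [← cobd_add]
    refine cobd_congr fun z hz => ?_
    exact H.chn_succ_eq (hy.inBd hu) (hz.inBd hv) (sg_two y) (rho_two y) fan p [lab u v]
  have e6 := H.hh_fan (2 * n - 1) (n - 1) n (by omega) (by omega) le_rfl
  rw [hh_add, hh_add, hh_add, hh_swap W, e4, CharTwo.add_self_eq_zero, CharTwo.add_self_eq_zero,
    zero_add, hh_cobd_left] at e5
  rw [show n - (n - 1) = 0 + 1 by omega, show n - 1 + 1 = n by omega, Nat.sub_self, hh_add] at e6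
  have e7 : hh (ZMod 2) k (0 + 1) n 0 (n + 1) (fun u v => chn lab fan (2 * n - 1) (ng u) v [])
      = hh (ZMod 2) k (0 + 1) n 0 (n + 1) (fun u v => chn lab fanN (2 * n - 1) u v []) := by
    refine hh_congr fun u v hu hv _ _ => ?_
    rw [show 0 + 1 + n = n + 1 by omega] at hu
    rw [zero_add] at hv
    rw [H.chn_ng_left hu hv, sg_two, one_mul]; rfl
  rw [e7, CharTwo.sub_eq_add, e6] at e5
  rw [eq_comm, ZMod.natCast_eq_zero_iff_even] at e5
  exact Nat.not_even_iff_odd.2 hch e5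

end Labelling
/-! ### Passage to continuous maps -/

section Continuous

/-- An index of a maximal entry. -/
noncomputable def maxIdx {m : ℕ} (a : Fin (m + 1) → ℝ) : Fin (m + 1) :=
  (Finite.exists_max a).choose

lemma le_maxIdx {m : ℕ} (a : Fin (m + 1) → ℝ) (i : Fin (m + 1)) : a i ≤ a (maxIdx a) :=
  (Finite.exists_max a).choose_spec i

/-- The signed position of an entry of maximal modulus of a vector. -/
noncomputable def lbl {m : ℕ} (w : Fin (m + 1) → ℝ) : Lab (m + 1) :=
  (maxIdx fun i => |w i|, decide (0 < w (maxIdx fun i => |w i|)))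

lemma norm_eq_maxIdx {m : ℕ} (w : Fin (m + 1) → ℝ) : ‖w‖ = |w (maxIdx fun i => |w i|)| :=
  le_antisymm ((pi_norm_le_iff_of_nonneg (abs_nonneg _)).2 fun i => le_maxIdx (fun i => |w i|) i)
    (norm_le_pi_norm w _)

lemma lbl_neg {m : ℕ} {w : Fin (m + 1) → ℝ} (hw : w ≠ 0) : lbl (-w) = lneg (lbl w) := by
  have h : w (maxIdx fun i => |w i|) ≠ 0 := by
    rwa [← abs_pos, ← norm_eq_maxIdx, norm_pos_iff]
  simp only [lbl, lneg, Pi.neg_apply, abs_neg, Prod.mk.injEq, true_and, Left.neg_pos_iff]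
  rw [← decide_not, decide_eq_decide, not_lt]
  exact ⟨le_of_lt, fun h' => lt_of_le_of_ne h' h⟩

lemma norm_le_of_lbl_eq {m : ℕ} {w w' : Fin (m + 1) → ℝ} (h : lbl w = lneg (lbl w')) :
    ‖w‖ ≤ ‖w - w'‖ := by
  rw [norm_eq_maxIdx]
  refine le_trans ?_ (norm_le_pi_norm (w - w') (maxIdx fun i => |w i|))
  simp only [lbl, lneg, Prod.mk.injEq, ← decide_not, decide_eq_decide, not_lt] at h
  obtain ⟨h1, h2⟩ := h
  rw [← h1] at h2
  rw [Real.norm_eq_abs, Pi.sub_apply]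
  rcases lt_or_ge 0 (w (maxIdx fun i => |w i|)) with h3 | h3
  · have := h2.1 h3
    rw [abs_of_pos h3]
    exact le_trans (by linarith) (le_abs_self _)
  · have : ¬ w' (maxIdx fun i => |w i|) ≤ 0 := fun h4 => absurd (h2.2 h4) h3.not_gt
    rw [abs_of_nonpos h3]
    refine le_trans ?_ (neg_le_abs _)
    linarith

/-- The barycentre of a cell of `[-2k, 2k]^d`, rescaled to the unit cube. -/
noncomputable def toVec (k d : ℕ) (u : List ℤ) : Fin d → ℝ := fun i => (u.getD i 0 : ℤ) / (2 * k)

lemma toVec_ng (k d : ℕ) (u : List ℤ) : toVec k d (ng u) = -toVec k d u := by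
  funext i
  have : (ng u).getD i 0 = -u.getD i 0 := by
    simpa [ng] using List.getD_map (l := u) (d := 0) (n := i) fun c : ℤ => -c
  rw [Pi.neg_apply, toVec, toVec, this, Int.cast_neg, neg_div]

lemma Face.abs_getD_sub_le {y u : List ℤ} (h : Face y u) (i : ℕ) :
    |y.getD i 0 - u.getD i 0| ≤ 1 := by
  induction h generalizing i with
  | nil => simp
  | cons hab _ ih =>
    cases i with
    | zero =>
      simp only [List.getD_cons_zero]
      rw [abs_le]
      omega
    | succ i => simpa using ih i

lemma Face.norm_toVec_sub_le {k d : ℕ} (hk : 0 < k) {a b u : List ℤ} (ha : Face a u)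
    (hb : Face b u) : ‖toVec k d a - toVec k d b‖ ≤ 1 / k := by
  have hk' : (0 : ℝ) < k := by exact_mod_cast hk
  refine (pi_norm_le_iff_of_nonneg (by positivity)).2 fun i => ?_
  have h : |a.getD i 0 - b.getD i 0| ≤ 2 := by
    have h1 := abs_le.1 (ha.abs_getD_sub_le i)
    have h2 := abs_le.1 (hb.abs_getD_sub_le i)
    rw [abs_le]
    omega
  have h' : |((a.getD i 0 : ℤ) : ℝ) - (b.getD i 0 : ℤ)| ≤ 2 := by exact_mod_cast h
  rw [Pi.sub_apply, toVec, toVec, ← sub_div, Real.norm_eq_abs, abs_div,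
    abs_of_pos (by positivity : (0 : ℝ) < 2 * k), div_le_div_iff₀ (by positivity) hk']
  nlinarith

lemma InBox.norm_toVec_le {k d : ℕ} (hk : 0 < k) {u : List ℤ} (hu : InBox k d u) :
    ‖toVec k d u‖ ≤ 1 := by
  have hk' : (0 : ℝ) < k := by exact_mod_cast hk
  refine (pi_norm_le_iff_of_nonneg zero_le_one).2 fun i => ?_
  have hi : (i : ℕ) < u.length := hu.1 ▸ i.2
  have h := hu.2 _ (List.getElem_mem hi)
  have h' : |((u[(i : ℕ)] : ℤ) : ℝ)| ≤ 2 * k := by exact_mod_cast h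
  rw [toVec, List.getD_eq_getElem _ _ hi, Real.norm_eq_abs, abs_div,
    abs_of_pos (by positivity : (0 : ℝ) < 2 * k)]
  exact div_le_one_of_le₀ h' (by positivity)

lemma InBd.norm_toVec {k d : ℕ} (hk : 0 < k) {u : List ℤ} (hu : InBd k d u) :
    ‖toVec k d u‖ = 1 := by
  have hk' : (0 : ℝ) < k := by exact_mod_cast hk
  refine le_antisymm (hu.1.norm_toVec_le hk) ?_
  obtain ⟨c, hc, hck⟩ := hu.2
  obtain ⟨i, hi, rfl⟩ := List.mem_iff_getElem.1 hc
  have h' : |((u[i] : ℤ) : ℝ)| = 2 * k := by exact_mod_cast hck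
  refine le_of_eq_of_le ?_ (norm_le_pi_norm (toVec k d u) ⟨i, hu.1.1 ▸ hi⟩)
  rw [toVec, List.getD_eq_getElem _ _ hi, Real.norm_eq_abs, abs_div, h',
    abs_of_pos (by positivity : (0 : ℝ) < 2 * k), div_self (by positivity)]

/-- A symmetric odd map on the product of two spheres of dimension `n`, extended to
a sphere times a ball, has a zero in `ℝ^(2n+1)`, under a parity condition on `n`. -/
theorem exists_zero {n : ℕ} (hn : Even n) (hn2 : 2 ≤ n)
    (hch : Odd ((2 * n - 1).choose (n - 1)))
    (F : (Fin (n + 1) → ℝ) → (Fin (n + 1) → ℝ) → Fin (2 * n + 1) → ℝ)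
    (hF : Continuous fun p : (Fin (n + 1) → ℝ) × (Fin (n + 1) → ℝ) => F p.1 p.2)
    (hleft : ∀ u v, ‖u‖ = 1 → ‖v‖ = 1 → F (-u) v = -F u v)
    (hright : ∀ u v, ‖u‖ = 1 → ‖v‖ = 1 → F u (-v) = -F u v)
    (hswap : ∀ u v, ‖u‖ = 1 → ‖v‖ = 1 → F v u = F u v) :
    ∃ u v, ‖u‖ = 1 ∧ ‖v‖ ≤ 1 ∧ F u v = 0 := by
  by_contra! hne
  set S : Set ((Fin (n + 1) → ℝ) × (Fin (n + 1) → ℝ)) :=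
    Metric.sphere 0 1 ×ˢ Metric.closedBall 0 1 with hSdef
  have hmem : ∀ u v, (u, v) ∈ S ↔ ‖u‖ = 1 ∧ ‖v‖ ≤ 1 := fun u v => by
    simp [hSdef]
  have hS : IsCompact S := (isCompact_sphere _ _).prod (isCompact_closedBall _ _)
  obtain ⟨p, hp, hmin⟩ := hS.exists_isMinOn
    ⟨(fun _ => 1, 0), (hmem _ _).2 ⟨by rw [pi_norm_const]; simp, by simp⟩⟩ hF.norm.continuousOn
  have hpos : 0 < ‖F p.1 p.2‖ :=
    norm_pos_iff.2 (hne p.1 p.2 ((hmem _ _).1 hp).1 ((hmem _ _).1 hp).2)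
  obtain ⟨ε, hε, hunif⟩ := Metric.uniformContinuousOn_iff.1
    (hS.uniformContinuousOn_of_continuous hF.continuousOn) _ hpos
  obtain ⟨k, hk⟩ := exists_nat_one_div_lt hε
  have hk0 : 0 < k + 1 := k.succ_pos
  refine IsLabelling.false (n := n) (k := k + 1)
    (lab := fun u v => lbl (F (toVec (k + 1) (n + 1) u) (toVec (k + 1) (n + 1) v)))
    ⟨?_, ?_, ?_, ?_⟩ hn hn2 hch
  · intro u v hu hv
    rw [toVec_ng, hleft _ _ (hu.norm_toVec hk0) (hv.norm_toVec hk0),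
      lbl_neg (hne _ _ (hu.norm_toVec hk0) (hv.norm_toVec hk0).le)]
  · intro u v hu hv
    rw [toVec_ng, hright _ _ (hu.norm_toVec hk0) (hv.norm_toVec hk0),
      lbl_neg (hne _ _ (hu.norm_toVec hk0) (hv.norm_toVec hk0).le)]
  · intro u v hu hv
    rw [hswap _ _ (hu.norm_toVec hk0) (hv.norm_toVec hk0)]
  · intro u v hu hv a a' b b' ha ha' hb hb' h
    have h1 : (toVec (k + 1) (n + 1) a, toVec (k + 1) (n + 1) b) ∈ S :=
      (hmem _ _).2 ⟨(ha.inBd hu).norm_toVec hk0, (hb.inBox hv).norm_toVec_le hk0⟩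
    have h2 : (toVec (k + 1) (n + 1) a', toVec (k + 1) (n + 1) b') ∈ S :=
      (hmem _ _).2 ⟨(ha'.inBd hu).norm_toVec hk0, (hb'.inBox hv).norm_toVec_le hk0⟩
    have hk1 : (1 : ℝ) / ((k + 1 : ℕ) : ℝ) < ε := by exact_mod_cast hk
    have h3 := hunif _ h1 _ h2 (by
      rw [Prod.dist_eq, dist_eq_norm, dist_eq_norm]
      exact max_lt ((ha.norm_toVec_sub_le hk0 ha').trans_lt hk1)
        ((hb.norm_toVec_sub_le hk0 hb').trans_lt hk1))
    rw [dist_eq_norm] at h3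
    exact absurd (((hmin h1).trans (norm_le_of_lbl_eq h)).trans_lt h3) (lt_irrefl _)

lemma odd_choose_two_pow_sub_one (k i : ℕ) (hi : i ≤ 2 ^ k - 1) : Odd ((2 ^ k - 1).choose i) := by
  induction i with
  | zero => simp
  | succ i ih =>
    have h1 : 2 ∣ (2 ^ k).choose (i + 1) :=
      Nat.prime_two.dvd_choose_pow (by omega) (by omega)
    have h2 : (2 ^ k).choose (i + 1) = (2 ^ k - 1).choose i + (2 ^ k - 1).choose (i + 1) := by
      conv_lhs => rw [show 2 ^ k = 2 ^ k - 1 + 1 by omega]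
      exact Nat.choose_succ_succ _ _
    obtain ⟨a, ha⟩ := ih (by omega)
    rw [Nat.odd_iff]
    omega

lemma odd_choose_two_pow {n k : ℕ} (hn : n = 2 ^ k) : Odd ((2 * n - 1).choose (n - 1)) := by
  rw [show 2 * n - 1 = 2 ^ (k + 1) - 1 by rw [hn, pow_succ']]
  exact odd_choose_two_pow_sub_one _ _ (by rw [hn, pow_succ']; omega)

end Continuous
end CubicalFan

/-! ### Phase retrieval and nonsingular symmetric bilinear maps -/

lemma Matrix.IsSymm.dotProduct_mulVec_comm {d : ℕ} {A : Matrix (Fin d) (Fin d) ℝ} (hA : A.IsSymm)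
    (u v : Fin d → ℝ) : v ⬝ᵥ A *ᵥ u = u ⬝ᵥ A *ᵥ v := by
  rw [dotProduct_mulVec, ← mulVec_transpose, hA.eq, dotProduct_comm]

lemma PhaseRetrievableR.eq_zero_or_eq_zero {d N : ℕ} {A : Fin N → Matrix (Fin d) (Fin d) ℝ}
    (hA : PhaseRetrievableR A) (hs : ∀ j, (A j).IsSymm) {u v : Fin d → ℝ}
    (h : ∀ j, u ⬝ᵥ A j *ᵥ v = 0) : u = 0 ∨ v = 0 := by
  have key := hA (u + v) (u - v) fun j => by
    simp only [mulVec_add, mulVec_sub, dotProduct_add, dotProduct_sub, add_dotProduct,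
      sub_dotProduct, (hs j).dotProduct_mulVec_comm u v, h j]
    ring
  rcases key with h1 | h1
  · right
    funext i
    have := congrFun h1 i
    simp only [Pi.add_apply, Pi.sub_apply, Pi.zero_apply] at this ⊢
    linarith
  · left
    funext i
    have := congrFun h1 i
    simp only [Pi.add_apply, Pi.sub_apply, Pi.zero_apply, Pi.neg_apply] at this ⊢
    linarith

lemma exists_phaseRetrievableR {d N : ℕ} {ι : Type*} [Fintype ι] (hN : Fintype.card ι = N)
    (M : ι → Matrix (Fin d) (Fin d) ℝ) (hs : ∀ j, (M j).IsSymm)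
    (h : ∀ u v, (∀ j, u ⬝ᵥ M j *ᵥ v = 0) → u = 0 ∨ v = 0) :
    ∃ A : Fin N → Matrix (Fin d) (Fin d) ℝ, (∀ j, (A j).IsSymm) ∧ PhaseRetrievableR A := by
  let e := Fintype.equivFinOfCardEq hN
  refine ⟨fun j => M (e.symm j), fun j => hs _, fun x y hxy => ?_⟩
  have key := h (x - y) (x + y) fun j => by
    have := hxy (e j)
    simp only [Equiv.symm_apply_apply] at this
    simp only [mulVec_add, dotProduct_add, sub_dotProduct, (hs j).dotProduct_mulVec_comm x y, this]
    ring
  exact key.imp sub_eq_zero.1 eq_neg_of_add_eq_zero_left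

section UpperBounds

lemma eq_zero_of_convolution {K : Type*} [Field K] {e : ℕ} {u v : Fin e → K}
    (h : ∀ m : Fin (2 * e - 1), ∑ i : Fin e, ∑ j : Fin e, (if (i + j : ℕ) = m then u i * v j else 0) = 0) :
    u = 0 ∨ v = 0 := by
  let P : (Fin e → K) → Polynomial K := fun w => ∑ i : Fin e, Polynomial.monomial (i : ℕ) (w i)
  have hP : ∀ w, P w = 0 → w = 0 := by
    intro w hw
    funext i
    have := congrArg (fun p => Polynomial.coeff p i) hw
    simpa [P, Polynomial.finsetSum_coeff, Polynomial.coeff_monomial, Fin.val_inj] using this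
  have hmul : P u * P v = 0 := by
    ext m
    simp only [P, Finset.sum_mul_sum, Polynomial.monomial_mul_monomial,
      Polynomial.finsetSum_coeff, Polynomial.coeff_monomial, Polynomial.coeff_zero]
    by_cases hm : m < 2 * e - 1
    · exact h ⟨m, hm⟩
    · refine Finset.sum_eq_zero fun i _ => Finset.sum_eq_zero fun j _ => if_neg ?_
      omega
  exact (mul_eq_zero.1 hmul).imp (hP u) (hP v)

lemma exists_phaseRetrievableR_hankel (d : ℕ) :
    ∃ A : Fin (2 * d - 1) → Matrix (Fin d) (Fin d) ℝ,
      (∀ j, (A j).IsSymm) ∧ PhaseRetrievableR A := by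
  refine exists_phaseRetrievableR (Fintype.card_fin _)
    (fun m => Matrix.of fun i j : Fin d => if (i + j : ℕ) = m then (1 : ℝ) else 0) ?_ ?_
  · intro m
    ext i j
    simp only [transpose_apply, of_apply, add_comm]
  · intro u v h
    refine eq_zero_of_convolution fun m => ?_
    have := h m
    simpa [dotProduct, mulVec, Finset.mul_sum] using this

/-- The vectors of `ℝ^(2e)`, viewed in `ℂ^e`. -/
noncomputable def toComplex {e : ℕ} (x : Fin (e * 2) → ℝ) (i : Fin e) : ℂ :=
  ∑ s : Fin 2, x (finProdFinEquiv (i, s)) * Complex.I ^ (s : ℕ)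

lemma eq_zero_of_toComplex {e : ℕ} {x : Fin (e * 2) → ℝ} (h : toComplex x = 0) : x = 0 := by
  funext a
  obtain ⟨⟨i, s⟩, rfl⟩ := finProdFinEquiv.surjective a
  have hi := congrFun h i
  rw [toComplex, Fin.sum_univ_two] at hi
  have hre := congrArg Complex.re hi
  have him := congrArg Complex.im hi
  fin_cases s
  · simpa using hre
  · simpa using him

/-- The complex matrices whose quadratic forms are the coefficients of the square of a complex
polynomial, as a function of the real and imaginary parts of its coefficients. -/
noncomputable def complexHankel (e m : ℕ) : Matrix (Fin (e * 2)) (Fin (e * 2)) ℂ :=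
  Matrix.of fun a b =>
    if ((finProdFinEquiv.symm a).1 + (finProdFinEquiv.symm b).1 : ℕ) = m then
      Complex.I ^ ((finProdFinEquiv.symm a).2 + (finProdFinEquiv.symm b).2 : ℕ) else 0

lemma sum_complexHankel (e m : ℕ) (x y : Fin (e * 2) → ℝ) :
    ∑ a, ∑ b, (x a * y b : ℂ) * complexHankel e m a b =
      ∑ i : Fin e, ∑ j : Fin e, (if (i + j : ℕ) = m then toComplex x i * toComplex y j else 0) := by
  rw [← finProdFinEquiv.sum_comp, Fintype.sum_prod_type]
  refine Finset.sum_congr rfl fun i _ => ?_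
  simp_rw [← finProdFinEquiv.sum_comp (fun b => _ * complexHankel e m _ b), Fintype.sum_prod_type]
  rw [Finset.sum_comm]
  refine Finset.sum_congr rfl fun j _ => ?_
  simp only [complexHankel, of_apply, Equiv.symm_apply_apply]
  split_ifs
  · rw [toComplex, toComplex, Finset.sum_mul_sum]
    refine Finset.sum_congr rfl fun s _ => Finset.sum_congr rfl fun t _ => ?_
    rw [pow_add]
    ring
  · simp

lemma exists_phaseRetrievableR_complex (e : ℕ) :
    ∃ A : Fin (2 * (e * 2) - 2) → Matrix (Fin (e * 2)) (Fin (e * 2)) ℝ,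
      (∀ j, (A j).IsSymm) ∧ PhaseRetrievableR A := by
  have hs : ∀ m a b, complexHankel e m b a = complexHankel e m a b := by
    intro m a b
    simp only [complexHankel, of_apply, add_comm]
  refine exists_phaseRetrievableR (ι := Fin (2 * e - 1) ⊕ Fin (2 * e - 1)) ?_
    (Sum.elim (fun m => (complexHankel e m).map Complex.re)
      fun m => (complexHankel e m).map Complex.im) ?_ ?_
  · rw [Fintype.card_sum, Fintype.card_fin]; omega
  · rintro (m | m) <;> ext a b <;> simp [hs m a b]
  · intro u v h
    refine (eq_zero_of_convolution fun m => ?_).imp eq_zero_of_toComplex eq_zero_of_toComplex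
    rw [← sum_complexHankel]
    have h1 := h (.inl m)
    have h2 := h (.inr m)
    apply Complex.ext
    · rw [Complex.zero_re, ← h1]
      simp [dotProduct, mulVec, Finset.mul_sum, mul_assoc, mul_comm (Complex.re _)]
    · rw [Complex.zero_im, ← h2]
      simp [dotProduct, mulVec, Finset.mul_sum, mul_assoc, mul_comm (Complex.im _)]

end UpperBounds

section LowerBounds

lemma PhaseRetrievableR.two_mul_lt {n k N : ℕ} (hk : 1 ≤ k) (hn : n = 2 ^ k)
    {A : Fin N → Matrix (Fin (n + 1)) (Fin (n + 1)) ℝ} (hs : ∀ j, (A j).IsSymm)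
    (hA : PhaseRetrievableR A) : 2 * n < N := by
  by_contra! hN
  obtain ⟨k, rfl⟩ := Nat.exists_eq_add_of_le' hk
  have hn' : n = 2 * 2 ^ k := by rw [hn, pow_succ']
  have hpos := Nat.one_le_two_pow (n := k)
  refine absurd (CubicalFan.exists_zero (n := n) (by simp [hn']) (by omega)
    (CubicalFan.odd_choose_two_pow hn)
    (fun u v i => if h : (i : ℕ) < N then u ⬝ᵥ A ⟨i, h⟩ *ᵥ v else
      if (i : ℕ) = 2 * n then 1 - ‖v‖ else 0) ?_ ?_ ?_ ?_) ?_
  · refine continuous_pi fun i => ?_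
    split_ifs
    · simp only [dotProduct, mulVec]
      fun_prop
    · fun_prop
    · fun_prop
  · intro u v hu hv
    funext i
    simp only [Pi.neg_apply]
    split_ifs <;> simp [hv]
  · intro u v hu hv
    funext i
    simp only [Pi.neg_apply, norm_neg]
    split_ifs <;> simp [hv, mulVec_neg]
  · intro u v hu hv
    funext i
    split_ifs
    · exact (hs _).dotProduct_mulVec_comm u v
    · rw [hu, hv]
    · rfl
  · rintro ⟨u, v, hu, hv, h⟩
    have h1 : ‖v‖ = 1 := by
      have := congrFun h (Fin.last _)
      simp only [Fin.val_last, hN.not_gt, dite_false, if_true, Pi.zero_apply] at this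
      linarith
    rcases hA.eq_zero_or_eq_zero hs (u := u) (v := v) fun j => by
        have := congrFun h ⟨j, by omega⟩
        simpa using this with rfl | rfl
    · simp at hu
    · simp at h1

lemma PhaseRetrievableR.two_mul_add_one_lt {n k N : ℕ} (hk : 1 ≤ k) (hn : n = 2 ^ k)
    {A : Fin N → Matrix (Fin (n + 2)) (Fin (n + 2)) ℝ} (hs : ∀ j, (A j).IsSymm)
    (hA : PhaseRetrievableR A) : 2 * n + 1 < N := by
  by_contra! hN
  obtain ⟨k, rfl⟩ := Nat.exists_eq_add_of_le' hk
  have hn' : n = 2 * 2 ^ k := by rw [hn, pow_succ']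
  have hpos := Nat.one_le_two_pow (n := k)
  have hneg : ∀ u : Fin (n + 1) → ℝ, (vecCons 0 (-u) : Fin (n + 2) → ℝ) = -vecCons 0 u := by
    intro u; simp
  refine absurd (CubicalFan.exists_zero (n := n) (by simp [hn']) (by omega)
    (CubicalFan.odd_choose_two_pow hn)
    (fun u v i => if h : (i : ℕ) < N then
      vecCons 0 u ⬝ᵥ A ⟨i, h⟩ *ᵥ vecCons (1 - ‖v‖) v else 0) ?_ ?_ ?_ ?_) ?_
  · refine continuous_pi fun i => ?_
    split_ifs
    · simp only [dotProduct, mulVec, Fin.sum_univ_succ, cons_val_zero, cons_val_succ]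
      fun_prop
    · fun_prop
  · intro u v hu hv
    funext i
    simp only [Pi.neg_apply]
    split_ifs
    · rw [hneg, neg_dotProduct]
    · simp
  · intro u v hu hv
    funext i
    simp only [Pi.neg_apply, norm_neg, hv, sub_self]
    split_ifs
    · rw [hneg, mulVec_neg, dotProduct_neg]
    · simp
  · intro u v hu hv
    funext i
    simp only [hu, hv, sub_self]
    split_ifs
    · exact (hs _).dotProduct_mulVec_comm _ _
    · rfl
  · rintro ⟨u, v, hu, hv, h⟩
    rcases hA.eq_zero_or_eq_zero hs (u := vecCons 0 u) (v := vecCons (1 - ‖v‖) v) fun j => by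
        have := congrFun h ⟨j, by omega⟩
        simpa using this with h1 | h1
    · have h2 : u = 0 := funext fun i => congrFun h1 i.succ
      simp [h2] at hu
    · have h2 : v = 0 := funext fun i => congrFun h1 i.succ
      have h3 : 1 - ‖v‖ = 0 := congrFun h1 0
      simp [h2] at h3

end LowerBounds

theorem stmt_16 (k d : ℕ) (hk : 1 ≤ k) :
    (d = 2 ^ k + 1 →
      (∃ A : Fin (2 * d - 1) → Matrix (Fin d) (Fin d) ℝ,
        (∀ j, (A j).IsSymm) ∧ PhaseRetrievableR A) ∧
      (∀ (N : ℕ) (A : Fin N → Matrix (Fin d) (Fin d) ℝ),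
        (∀ j, (A j).IsSymm) → PhaseRetrievableR A → 2 * d - 1 ≤ N)) ∧
    (d = 2 ^ k + 2 →
      (∃ A : Fin (2 * d - 2) → Matrix (Fin d) (Fin d) ℝ,
        (∀ j, (A j).IsSymm) ∧ PhaseRetrievableR A) ∧
      (∀ (N : ℕ) (A : Fin N → Matrix (Fin d) (Fin d) ℝ),
        (∀ j, (A j).IsSymm) → PhaseRetrievableR A → 2 * d - 2 ≤ N)) := by
  refine ⟨?_, ?_⟩
  · rintro rfl
    refine ⟨exists_phaseRetrievableR_hankel _, fun N A hs hA => ?_⟩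
    have := hA.two_mul_lt hk rfl hs
    omega
  · intro hd
    refine ⟨?_, ?_⟩
    · obtain ⟨k, rfl⟩ := Nat.exists_eq_add_of_le' hk
      obtain rfl : d = (2 ^ k + 1) * 2 := by rw [hd, pow_succ]; ring
      exact exists_phaseRetrievableR_complex _
    · subst hd
      intro N A hs hA
      have := hA.two_mul_add_one_lt hk rfl hs
      omega
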